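/- arXiv:2110.13320 — 7 statements merged into one kernel-verified Lean document; each statement's English description precedes it below -/
import Mathlib

section
/- Let G be a finite group such that φ(S) ≠ 0 for every subgroup S of G, and such that for all subgroups H, K of G with H ⊆ K, φ(H) divides φ(K). Then G is nilpotent. -/
/-- For a finite group `G`, `phi G` is the number of elements of `G` whose order
equals the exponent of `G`. -/
noncomputable def phi (G : Type*) [Group G] : ℕ :=
  Nat.card {a : G // orderOf a = Monoid.exponent G}

theorem commute_of_isNilpotent {G : Type*} [Group G] [Finite G] {H : Subgroup G}
    (hH : Group.IsNilpotent H) {p q : ℕ} (hp : p.Prime) (hq : q.Prime) (hpq : p ≠ q) {a b : G}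
    (haH : a ∈ H) (hbH : b ∈ H) {i j : ℕ} (ha : a ^ p ^ i = 1) (hb : b ^ q ^ j = 1) :
    Commute a b := by
  have := Fact.mk hp
  have := Fact.mk hq
  have key : ∀ {r k : ℕ} [Fact r.Prime] (x : H), x ^ r ^ k = 1 → ∃ S : Sylow r H, x ∈ S := by
    intro r k _ x hx
    obtain ⟨l, -, hl⟩ := (Nat.dvd_prime_pow (Fact.out : r.Prime)).1 (orderOf_dvd_of_pow_eq_one hx)
    have : IsPGroup r (Subgroup.zpowers x) := IsPGroup.of_card (by rw [Nat.card_zpowers, hl])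
    obtain ⟨S, hS⟩ := this.exists_le_sylow
    exact ⟨S, hS (Subgroup.mem_zpowers x)⟩
  obtain ⟨P, hP⟩ := key (⟨a, haH⟩ : H) (Subtype.ext ha)
  obtain ⟨Q, hQ⟩ := key (⟨b, hbH⟩ : H) (Subtype.ext hb)
  have hn := (Group.isNilpotent_of_finite_tfae (G := H)).out 0 3 |>.1 hH
  have hPn := hn p ‹_› P
  have hQn := hn q ‹_› Q
  exact congrArg Subtype.val (Subgroup.commute_of_normal_of_disjoint _ _ hPn hQn
    (IsPGroup.disjoint_of_ne p q hpq _ _ P.2 Q.2) _ _ hP hQ : _ * _ = _)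

theorem exists_normal_isPGroup {G : Type*} [Group G] [Finite G] {N : Subgroup G} [N.Normal]
    (hN : Group.IsNilpotent N) {q : ℕ} (hq : q.Prime) :
    ∃ S : Subgroup G, S.Normal ∧ IsPGroup q S ∧ ∀ x ∈ N, ∀ k : ℕ, x ^ q ^ k = 1 → x ∈ S := by
  have := Fact.mk hq
  let S : Sylow q N := default
  have hS : (S : Subgroup N).Normal :=
    ((Group.isNilpotent_of_finite_tfae (G := N)).out 0 3 :
      Group.IsNilpotent N ↔ ∀ (p : ℕ) (_ : Fact p.Prime) (P : Sylow p N), (P : Subgroup N).Normal).1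
      hN q ‹_› S
  have hc := Sylow.characteristic_of_normal S hS
  refine ⟨(S : Subgroup N).map N.subtype, inferInstance, S.2.map _, fun x hx k hk => ?_⟩
  obtain ⟨l, -, hl⟩ := (Nat.dvd_prime_pow hq).1
    (orderOf_dvd_of_pow_eq_one (show (⟨x, hx⟩ : N) ^ q ^ k = 1 from Subtype.ext hk))
  have : IsPGroup q (Subgroup.zpowers (⟨x, hx⟩ : N)) :=
    IsPGroup.of_card (by rw [Nat.card_zpowers, hl])
  obtain ⟨T, hT⟩ := this.exists_le_sylow
  have := Sylow.unique_of_normal S hS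
  obtain rfl : T = S := Subsingleton.elim _ _
  exact ⟨⟨x, hx⟩, hT (Subgroup.mem_zpowers _), rfl⟩

theorem isNilpotent_subgroupMap {G H : Type*} [Group G] [Group H] (f : G →* H) {K : Subgroup G}
    (hK : Group.IsNilpotent K) : Group.IsNilpotent (K.map f) :=
  Group.nilpotent_of_surjective (f.subgroupMap K) (f.subgroupMap_surjective K)

theorem lt_normalizer_inf {G : Type*} [Group G] {M D : Subgroup G}
    (hM : Group.IsNilpotent M) (hD : D < M) : D < Subgroup.normalizer (D : Set G) ⊓ M := by
  refine lt_of_le_of_ne (le_inf Subgroup.le_normalizer hD.le) fun heq => hD.not_ge ?_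
  rw [← Subgroup.subgroupOf_eq_top]
  refine normalizerCondition_iff_only_full_group_self_normalizing.1
    (Group.normalizerCondition_of_isNilpotent (G := M)) _ ?_
  rw [← Subgroup.subgroupOf_normalizer_eq hD.le, ← Subgroup.inf_subgroupOf_right, ← heq]

theorem normalizer_ne_top_of_isSimpleGroup {G : Type*} [Group G] [IsSimpleGroup G]
    {D : Subgroup G} (hD : D ≠ ⊥) (hD' : D ≠ ⊤) : Subgroup.normalizer (D : Set G) ≠ ⊤ := by
  rw [Ne, Subgroup.normalizer_eq_top_iff]
  exact fun h => h.eq_bot_or_eq_top.elim hD hD'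

theorem inf_eq_bot_of_isCoatom {G : Type*} [Group G] [Finite G] [IsSimpleGroup G]
    (h : ∀ H : Subgroup G, H ≠ ⊤ → Group.IsNilpotent H) {M L : Subgroup G} (hM : IsCoatom M)
    (hL : IsCoatom L) (hML : M ≠ L) : M ⊓ L = ⊥ := by
  by_contra hbot
  obtain ⟨⟨A, B⟩, ⟨hA, hB, hAB, hne⟩, hmax⟩ := Set.exists_max_image
    {x : Subgroup G × Subgroup G | IsCoatom x.1 ∧ IsCoatom x.2 ∧ x.1 ≠ x.2 ∧ x.1 ⊓ x.2 ≠ ⊥}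
    (fun x => Nat.card (x.1 ⊓ x.2 : Subgroup G)) (Set.toFinite _) ⟨(M, L), hM, hL, hML, hbot⟩
  dsimp only at hA hB hAB hne hmax
  have hltA : A ⊓ B < A := inf_lt_left.2 fun hle => hAB (hA.le_iff_eq hB.1 |>.1 hle).symm
  have hltB : A ⊓ B < B := inf_lt_right.2 fun hle => hAB (hB.le_iff_eq hA.1 |>.1 hle)
  obtain ⟨K, hK, hNK⟩ := (eq_top_or_exists_le_coatom _).resolve_left
    (normalizer_ne_top_of_isSimpleGroup hne (hltA.trans_le le_top).ne)
  have key : ∀ X : Subgroup G, IsCoatom X → A ⊓ B < X → K = X := by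
    intro X hX hlt
    by_contra hKX
    have h1 : A ⊓ B < K ⊓ X :=
      (lt_normalizer_inf (h X hX.1) hlt).trans_le (inf_le_inf_right X hNK)
    have h2 := hmax (K, X) ⟨hK, hX, hKX, ((bot_le).trans_lt h1).ne'⟩
    exact (Set.Finite.card_lt_card (Set.toFinite _) (SetLike.coe_ssubset_coe.2 h1)).not_ge h2
  exact hAB ((key A hA hltA).symm.trans (key B hB hltB))

theorem conj_mem_iff_of_isCoatom {G : Type*} [Group G] [Finite G] [IsSimpleGroup G]
    (h : ∀ H : Subgroup G, H ≠ ⊤ → Group.IsNilpotent H) {M L : Subgroup G} (hM : IsCoatom M)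
    (hL : IsCoatom L) {x g k : G} (hx : x ≠ 1) (hxg : g⁻¹ * x * g ∈ M) (hxk : k⁻¹ * x * k ∈ L)
    (y : G) :
    g⁻¹ * y * g ∈ M ↔ k⁻¹ * y * k ∈ L := by
  have hcoatom : ∀ (X : Subgroup G) (c : G), IsCoatom X →
      IsCoatom (X.comap (MulAut.conj c).toMonoidHom) := fun X c hX => by
    have := (MulEquiv.comapSubgroup (MulAut.conj c)).isCoatom_iff X
    exact this.2 hX
  have hmem : ∀ (X : Subgroup G) (c y : G),
      y ∈ X.comap (MulAut.conj c⁻¹).toMonoidHom ↔ c⁻¹ * y * c ∈ X := fun X c y => by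
    simp [Subgroup.mem_comap]
  rw [← hmem, ← hmem]
  suffices M.comap (MulAut.conj g⁻¹).toMonoidHom = L.comap (MulAut.conj k⁻¹).toMonoidHom by
    rw [this]
  by_contra hne
  have := inf_eq_bot_of_isCoatom h (hcoatom M g⁻¹ hM) (hcoatom L k⁻¹ hL) hne
  exact hx (Subgroup.mem_bot.1 (this ▸ Subgroup.mem_inf.2 ⟨(hmem ..).2 hxg, (hmem ..).2 hxk⟩))

/-- Conjugates of the nontrivial elements of `M` by coset representatives. -/
noncomputable def conjRep {G : Type*} [Group G] (M : Subgroup G)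
    (z : (G ⧸ M) × {m : M // m ≠ 1}) : G :=
  z.1.out * z.2.1 * z.1.out⁻¹

theorem conjRep_ne_one {G : Type*} [Group G] (M : Subgroup G) (z) : conjRep M z ≠ 1 := by
  obtain ⟨c, m, hm⟩ := z
  simp only [conjRep, ne_eq, conj_eq_one_iff]
  simpa using hm

theorem conjRep_mem {G : Type*} [Group G] (M : Subgroup G) (z) :
    z.1.out⁻¹ * conjRep M z * z.1.out ∈ M := by
  have : z.1.out⁻¹ * conjRep M z * z.1.out = z.2.1 := by rw [conjRep]; group
  rw [this]
  exact z.2.1.2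

theorem mem_range_conjRep {G : Type*} [Group G] {M : Subgroup G} {g x : G} (hx : x ≠ 1)
    (h : g⁻¹ * x * g ∈ M) : x ∈ Set.range (conjRep M) := by
  obtain ⟨m, hm⟩ := QuotientGroup.mk_out_eq_mul M g
  refine ⟨⟨(g : G ⧸ M), ⟨m⁻¹ * ⟨_, h⟩ * m, ?_⟩⟩, ?_⟩
  · have : (g⁻¹ * x * g) ≠ 1 := by simpa [mul_assoc, inv_mul_eq_one] using hx
    intro h1
    have h2 := (conj_eq_one_iff (a := m⁻¹)).1 (by simpa using h1)
    exact this (congrArg Subtype.val h2)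
  · simp only [conjRep, hm]
    push_cast
    group

theorem conjRep_injective {G : Type*} [Group G] [Finite G] [IsSimpleGroup G]
    (h : ∀ H : Subgroup G, H ≠ ⊤ → Group.IsNilpotent H) {M : Subgroup G} (hM : IsCoatom M)
    (hbot : M ≠ ⊥) : Function.Injective (conjRep M) := by
  intro z w hzw
  have hz := conjRep_mem M z
  have hw := conjRep_mem M w
  rw [← hzw] at hw
  have key := conj_mem_iff_of_isCoatom h hM hM (conjRep_ne_one M z) hz hw
  have hN : Subgroup.normalizer (M : Set G) = M :=
    ((hM.le_iff_eq (normalizer_ne_top_of_isSimpleGroup hbot hM.1)).1 Subgroup.le_normalizer)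
  have hzw1 : z.1 = w.1 := by
    rw [← z.1.out_eq, ← w.1.out_eq]
    refine QuotientGroup.eq.2 (hN.le ?_)
    rw [Subgroup.mem_normalizer_iff]
    intro y
    have := key (w.1.out * y * w.1.out⁻¹)
    simp only [mul_assoc, inv_mul_cancel_left, inv_mul_cancel, mul_one] at this ⊢
    simpa using this.symm
  obtain ⟨a, b⟩ := z
  obtain ⟨c, d⟩ := w
  obtain rfl : a = c := hzw1
  simp only [conjRep, mul_left_inj, mul_right_inj] at hzw
  exact Prod.ext rfl (Subtype.ext (Subtype.ext hzw))

theorem card_range_conjRep {G : Type*} [Group G] [Finite G] [IsSimpleGroup G]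
    (h : ∀ H : Subgroup G, H ≠ ⊤ → Group.IsNilpotent H) {M : Subgroup G} (hM : IsCoatom M)
    (hbot : M ≠ ⊥) : (Set.range (conjRep M)).ncard + M.index = Nat.card G := by
  have hpos : 0 < Nat.card M := Nat.card_pos
  have : Nat.card {m : M // m ≠ 1} + 1 = Nat.card M := by
    have := Set.ncard_compl_add_ncard ({1} : Set M)
    rwa [Set.ncard_singleton, ← Nat.card_coe_set_eq] at this
  rw [← Nat.card_coe_set_eq, Nat.card_range_of_injective (conjRep_injective h hM hbot),
    Nat.card_prod, ← M.index_mul_card, ← this, Subgroup.index]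
  ring

theorem prime_card_of_isSimpleGroup {G : Type*} [Group G] [Finite G] [IsSimpleGroup G]
    (h : ∀ H : Subgroup G, H ≠ ⊤ → Group.IsNilpotent H) : (Nat.card G).Prime := by
  by_contra hprime
  have hz : ∀ x : G, Subgroup.zpowers x ≠ ⊤ := fun x hx => hprime <| by
    have : IsCyclic G := ⟨x, fun y => hx.ge (Subgroup.mem_top y)⟩
    let := IsCyclic.commGroup (α := G)
    exact IsSimpleGroup.prime_card
  have hex : ∀ x : G, ∃ M : Subgroup G, IsCoatom M ∧ x ∈ M := fun x => by
    obtain ⟨M, hM, hxM⟩ := (eq_top_or_exists_le_coatom _).resolve_left (hz x)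
    exact ⟨M, hM, hxM (Subgroup.mem_zpowers x)⟩
  have hbot : ∀ M : Subgroup G, IsCoatom M → M ≠ ⊥ := by
    rintro M hM rfl
    obtain ⟨x, hx⟩ := exists_ne (1 : G)
    exact hz x (hM.2 _ (bot_lt_iff_ne_bot.2 (by simpa using hx)))
  have hindex : ∀ M : Subgroup G, IsCoatom M → 2 * M.index ≤ Nat.card G := fun M hM => by
    rw [← M.card_mul_index]
    have := (Subgroup.one_lt_card_iff_ne_bot M).2 (hbot M hM)
    gcongr
    omega
  obtain ⟨M, hM, -⟩ := hex 1
  have hcardM := card_range_conjRep h hM (hbot M hM)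
  have hM2 : 2 ≤ M.index := by
    have := M.index_ne_zero_of_finite
    have := mt Subgroup.index_eq_one.1 hM.1
    omega
  have hone : ∀ s : Set G, (1 : G) ∉ s → s.ncard + 1 ≤ Nat.card G := fun s hs => by
    rw [← Set.ncard_insert_of_notMem hs, ← Set.ncard_univ]
    exact Set.ncard_le_ncard (Set.subset_univ _)
  have h1 : ∀ L : Subgroup G, (1 : G) ∉ Set.range (conjRep L) := fun L => by
    rintro ⟨z, hz⟩
    exact conjRep_ne_one L z hz
  obtain ⟨x, hx1, hx⟩ : ∃ x : G, x ≠ 1 ∧ x ∉ Set.range (conjRep M) := by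
    by_contra! hall
    have : Set.univ ⊆ insert 1 (Set.range (conjRep M)) := fun x _ =>
      (eq_or_ne x 1).imp id (hall x)
    have := Set.ncard_le_ncard this
    rw [Set.ncard_insert_of_notMem (h1 M), Set.ncard_univ] at this
    omega
  obtain ⟨L, hL, hxL⟩ := hex x
  have hcardL := card_range_conjRep h hL (hbot L hL)
  have hdisj : Disjoint (Set.range (conjRep M)) (Set.range (conjRep L)) := by
    rw [Set.disjoint_left]
    rintro _ ⟨z, rfl⟩ ⟨w, hw⟩
    have hw' := conjRep_mem L w
    rw [hw] at hw'
    refine hx (mem_range_conjRep hx1 (g := w.1.out⁻¹ * z.1.out) ?_)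
    have := (conj_mem_iff_of_isCoatom h hM hL (conjRep_ne_one M z) (conjRep_mem M z) hw'
      (w.1.out * x * w.1.out⁻¹)).2 (by simpa [mul_assoc] using hxL)
    simpa [mul_assoc] using this
  have hunion := hone (Set.range (conjRep M) ∪ Set.range (conjRep L))
    (not_or.2 ⟨h1 M, h1 L⟩)
  rw [Set.ncard_union_eq hdisj] at hunion
  have := hindex M hM
  have := hindex L hL
  omega

theorem exists_normal_prime_index {G : Type*} [Group G] [Finite G] [Nontrivial G]
    (h : ∀ H : Subgroup G, H ≠ ⊤ → Group.IsNilpotent H) :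
    ∃ N : Subgroup G, N.Normal ∧ N.index.Prime := by
  obtain ⟨N, ⟨hN, hNtop⟩, hmax⟩ := Set.Finite.exists_maximal
    (Set.toFinite {N : Subgroup G | N.Normal ∧ N ≠ ⊤}) ⟨⊥, inferInstance, bot_ne_top⟩
  have hnt : Nontrivial (G ⧸ N) := QuotientGroup.nontrivial_iff.2 hNtop
  have hsimple : IsSimpleGroup (G ⧸ N) := ⟨fun K hK => by
    by_contra! hK'
    have hle : N ≤ K.comap (QuotientGroup.mk' N) := by
      simpa using (QuotientGroup.mk' N).ker_le_comap K
    have := hmax (y := K.comap (QuotientGroup.mk' N)) ⟨inferInstance, fun htop => hK'.2 ?_⟩ hle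
    · refine hK'.1 ?_
      rw [← Subgroup.map_comap_eq_self_of_surjective (QuotientGroup.mk'_surjective N) K,
        le_antisymm this hle]
      simp
    · rw [← Subgroup.map_comap_eq_self_of_surjective (QuotientGroup.mk'_surjective N) K, htop,
        Subgroup.map_top_of_surjective _ (QuotientGroup.mk'_surjective N)]⟩
  refine ⟨N, hN, prime_card_of_isSimpleGroup fun H hH => ?_⟩
  rw [← Subgroup.map_comap_eq_self_of_surjective (QuotientGroup.mk'_surjective N) H]
  refine isNilpotent_subgroupMap _ (h _ fun htop => hH ?_)
  rw [← Subgroup.map_comap_eq_self_of_surjective (QuotientGroup.mk'_surjective N) H, htop,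
        Subgroup.map_top_of_surjective _ (QuotientGroup.mk'_surjective N)]

theorem mem_of_pow_mem_of_coprime {G : Type*} [Group G] {H : Subgroup G} {x : G} {m n : ℕ}
    (hmn : m.Coprime n) (hm : x ^ m ∈ H) (hn : x ^ n ∈ H) : x ∈ H := by
  have h : x ^ (m * m.gcdA n + n * m.gcdB n) = x := by
    rw [← Nat.gcd_eq_gcd_ab, Nat.coprime_iff_gcd_eq_one.1 hmn, Nat.cast_one, zpow_one]
  rw [← h, zpow_add, zpow_mul, zpow_mul, zpow_natCast, zpow_natCast]
  exact H.mul_mem (H.zpow_mem hm _) (H.zpow_mem hn _)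

theorem exists_structure_of_minimal_not_isNilpotent {G : Type*} [Group G] [Finite G]
    (h : ∀ H : Subgroup G, H ≠ ⊤ → Group.IsNilpotent H) (hG : ¬ Group.IsNilpotent G) :
    ∃ p q b : ℕ, p.Prime ∧ q.Prime ∧ p ≠ q ∧ ∃ (P : Subgroup G) (y : G), P.Normal ∧ IsPGroup p P ∧
      orderOf y = q ^ b ∧ Subgroup.zpowers y ⊔ P = ⊤ ∧ ∃ u ∈ P, ¬ Commute y u := by
  have hnt : Nontrivial G := by
    by_contra hs
    rw [not_nontrivial_iff_subsingleton] at hs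
    exact hG inferInstance
  obtain ⟨N, hN, hq⟩ := exists_normal_prime_index h
  set q := N.index with hqdef
  have hNtop : N ≠ ⊤ := fun htop => hq.one_lt.ne' (by rw [hqdef, htop, Subgroup.index_top])
  have hnormal : ∀ (r : ℕ) (_ : Fact r.Prime), r ≠ q →
      ∀ R : Sylow r G, (R : Subgroup G).Normal := by
    intro r hr hrq R
    obtain ⟨S, hS, hSr, hNS⟩ := exists_normal_isPGroup (h N hNtop) hr.out
    have hRS : (R : Subgroup G) ≤ S := fun x hx => by
      obtain ⟨k, hk⟩ := R.2 ⟨x, hx⟩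
      have hk' : x ^ r ^ k = 1 := congrArg Subtype.val hk
      refine hNS x (mem_of_pow_mem_of_coprime (m := q) (n := r ^ k) ?_
        (Subgroup.pow_index_mem N x) (hk' ▸ N.one_mem)) k hk'
      exact Nat.Coprime.pow_right k ((Nat.coprime_primes hq hr.out).2 hrq.symm)
    rw [← R.3 hSr hRS]
    exact hS
  by_contra! hcon
  refine hG (((Group.isNilpotent_of_finite_tfae (G := G)).out 0 3 :
      Group.IsNilpotent G ↔ ∀ (p : ℕ) (_ : Fact p.Prime) (P : Sylow p G), (P : Subgroup G).Normal).2
      fun p hp P => ?_)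
  by_cases hpq : p = q
  swap
  · exact hnormal p hp hpq P
  subst hpq
  rw [← Subgroup.normalizer_eq_top_iff, ← Subgroup.index_eq_one]
  by_contra hne
  obtain ⟨r, hr, hdvd⟩ := Nat.exists_prime_and_dvd hne
  have := Fact.mk hr
  have hcontra : ∀ {r : ℕ} [Fact r.Prime] (R : Sylow r G),
      (R : Subgroup G) ≤ Subgroup.normalizer (P : Set G) →
      ¬ r ∣ (Subgroup.normalizer (P : Set G)).index := fun {r} _ R hR hd => by
    exact R.not_dvd_index (hd.trans (Subgroup.index_dvd_of_le hR))
  by_cases hrp : r = q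
  · subst hrp
    exact hcontra P Subgroup.le_normalizer hdvd
  let R : Sylow r G := default
  refine hcontra R ?_ hdvd
  refine le_trans ?_ (Subgroup.centralizer_le_normalizer (P : Set G))
  intro u hu
  rw [Subgroup.mem_centralizer_iff]
  intro y hy
  obtain ⟨k, hk⟩ := IsPGroup.iff_orderOf.1 P.2 ⟨y, hy⟩
  rw [Subgroup.orderOf_mk] at hk
  have hRn := hnormal r ‹_› hrp R
  by_cases htop : Subgroup.zpowers y ⊔ (R : Subgroup G) = ⊤
  · exact hcon r q k hr hq hrp R y hRn R.2 hk htop u hu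
  · obtain ⟨l, hl⟩ := R.2 ⟨u, hu⟩
    exact commute_of_isNilpotent (h _ htop) hp.out hr (Ne.symm hrp)
      (Subgroup.mem_sup_left (Subgroup.mem_zpowers y)) (Subgroup.mem_sup_right hu)
      (i := k) (j := l) (hk ▸ pow_orderOf_eq_one y) (congrArg Subtype.val hl)

theorem phi_congr {G H : Type*} [Group G] [Group H] (e : G ≃* H) : phi G = phi H :=
  Nat.card_congr (e.toEquiv.subtypeEquiv fun a => by
    rw [MulEquiv.toEquiv_eq_coe, EquivLike.coe_coe, e.orderOf_eq,
      Monoid.exponent_eq_of_mulEquiv e])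

theorem phi_prod {G H : Type*} [Group G] [Group H] [Finite G] [Finite H]
    (hGH : (Monoid.exponent G).Coprime (Monoid.exponent H)) : phi (G × H) = phi G * phi H := by
  rw [phi, phi, phi, ← Nat.card_prod]
  refine Nat.card_congr ((Equiv.subtypeEquivRight fun a => ?_).trans
    (Equiv.subtypeProdEquivProd (p := fun a : G => orderOf a = Monoid.exponent G)
      (q := fun c : H => orderOf c = Monoid.exponent H)))
  have h1 := Monoid.order_dvd_exponent a.1
  have h2 := Monoid.order_dvd_exponent a.2
  rw [Prod.orderOf, Monoid.exponent_prod, lcm_eq_nat_lcm, hGH.lcm_eq_mul,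
    (Nat.Coprime.of_dvd h1 h2 hGH).lcm_eq_mul]
  refine ⟨fun heq => ?_, fun heq => by rw [heq.1, heq.2]⟩
  have hG := Nat.pos_of_ne_zero (Monoid.exponent_ne_zero_of_finite (G := G))
  have hH := Nat.pos_of_ne_zero (Monoid.exponent_ne_zero_of_finite (G := H))
  have h1' := Nat.le_of_dvd hG h1
  have h2' := Nat.le_of_dvd hH h2
  have := orderOf_pos a.1
  have := orderOf_pos a.2
  constructor
  · by_contra hne
    nlinarith [lt_of_le_of_ne h1' hne]
  · by_contra hne
    nlinarith [lt_of_le_of_ne h2' hne]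

theorem card_orderOf_eq_totient {G : Type*} [Group G] [Finite G] [IsCyclic G] :
    Nat.card {a : G // orderOf a = Nat.card G} = (Nat.card G).totient := by
  classical
  have := Fintype.ofFinite G
  rw [← IsCyclic.card_orderOf_eq_totient (α := G) Nat.card_eq_fintype_card.dvd,
    Nat.card_eq_fintype_card, Fintype.card_subtype]

theorem phi_of_isCyclic {G : Type*} [Group G] [Finite G] [IsCyclic G] :
    phi G = (Nat.card G).totient := by
  rw [phi, IsCyclic.exponent_eq_card, card_orderOf_eq_totient]

theorem exponent_eq_prime {G : Type*} [Group G] [Nontrivial G] {p : ℕ} (hp : p.Prime)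
    (h : ∀ x : G, x ^ p = 1) : Monoid.exponent G = p := by
  refine ((Nat.dvd_prime hp).1 (Monoid.exponent_dvd_of_forall_pow_eq_one h)).resolve_left ?_
  rw [Monoid.exp_eq_one_iff]
  exact not_subsingleton G

theorem phi_of_pow_prime_eq_one {G : Type*} [Group G] [Finite G] [Nontrivial G] {p : ℕ}
    (hp : p.Prime) (h : ∀ x : G, x ^ p = 1) : phi G = Nat.card G - 1 := by
  classical
  have := Fintype.ofFinite G
  have key : phi G = Nat.card {a : G // a ≠ 1} :=
      Nat.card_congr (Equiv.subtypeEquivRight fun a => by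
    rw [exponent_eq_prime hp h]
    refine ⟨?_, fun ha => ?_⟩
    · rintro ha rfl
      exact hp.one_lt.ne (orderOf_one.symm.trans ha)
    · have := Fact.mk hp
      exact orderOf_eq_prime (h a) ha)
  rw [key, Nat.card_eq_fintype_card, Nat.card_eq_fintype_card, Fintype.card_subtype_compl,
    Fintype.card_subtype_eq]

theorem phi_sup {G : Type*} [Group G] [Finite G] {A B : Subgroup G}
    (hcomm : ∀ a ∈ A, ∀ c ∈ B, Commute a c) (hAB : (Nat.card A).Coprime (Nat.card B)) :
    phi (A ⊔ B : Subgroup G) = phi A * phi B := by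
  let f : A × B →* G := A.subtype.noncommCoprod B.subtype fun a c => hcomm a a.2 c c.2
  have hf : Function.Injective f := (MonoidHom.noncommCoprod_injective _ _ _).2
    ⟨A.subtype_injective, B.subtype_injective, by
      rw [A.range_subtype, B.range_subtype]
      exact Subgroup.disjoint_of_coprime_natCard hAB⟩
  have hrange : f.range = A ⊔ B := by
    rw [show f.range = _ from MonoidHom.noncommCoprod_range _ _ _, A.range_subtype, B.range_subtype]
  rw [← hrange, ← phi_congr (MonoidHom.ofInjective hf)]
  exact phi_prod (Nat.Coprime.of_dvd Group.exponent_dvd_nat_card Group.exponent_dvd_nat_card hAB)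

/-- The structure of a finite minimal non-nilpotent group: a normal `p`-subgroup `P` extended by
a cyclic `q`-group generated by `y` that does not centralize `P`. -/
structure IsMinimalNonNilpotent {G : Type*} [Group G] (p q b : ℕ) (P : Subgroup G) (y : G) :
    Prop where
  isNilpotent : ∀ H : Subgroup G, H ≠ ⊤ → Group.IsNilpotent H
  prime_left : p.Prime
  prime_right : q.Prime
  ne : p ≠ q
  normal : P.Normal
  isPGroup : IsPGroup p P
  orderOf_eq : orderOf y = q ^ b
  sup_eq_top : Subgroup.zpowers y ⊔ P = ⊤
  exists_not_commute : ∃ u ∈ P, ¬ Commute y u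

namespace IsMinimalNonNilpotent

open scoped commutatorElement

variable {G : Type*} [Group G] {p q b : ℕ} {P : Subgroup G} {y : G}

theorem exists_pow_eq_one (h : IsMinimalNonNilpotent p q b P y) {u : G} (hu : u ∈ P) :
    ∃ k, u ^ p ^ k = 1 := by
  obtain ⟨k, hk⟩ := h.isPGroup ⟨u, hu⟩
  exact ⟨k, congrArg Subtype.val hk⟩

theorem coprime_pow (h : IsMinimalNonNilpotent p q b P y) (i j : ℕ) :
    (p ^ i).Coprime (q ^ j) :=
  ((Nat.coprime_primes h.prime_left h.prime_right).2 h.ne).pow i j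

theorem eq_one_of_pow_eq_one (h : IsMinimalNonNilpotent p q b P y) {u : G} (hu : u ∈ P) {j : ℕ}
    (hj : u ^ q ^ j = 1) : u = 1 := by
  obtain ⟨k, hk⟩ := h.exists_pow_eq_one hu
  exact Subgroup.mem_bot.1 (mem_of_pow_mem_of_coprime (h.coprime_pow k j)
    (Subgroup.mem_bot.2 hk) (Subgroup.mem_bot.2 hj))

theorem pow_eq_one_of_mem_zpowers (h : IsMinimalNonNilpotent p q b P y) {z : G}
    (hz : z ∈ Subgroup.zpowers y) : z ^ q ^ b = 1 := by
  rw [← h.orderOf_eq, ← orderOf_dvd_iff_pow_eq_one]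
  exact orderOf_dvd_of_mem_zpowers hz

theorem disjoint (h : IsMinimalNonNilpotent p q b P y) : Disjoint P (Subgroup.zpowers y) := by
  rw [Subgroup.disjoint_def]
  exact fun hP hz => h.eq_one_of_pow_eq_one hP (h.pow_eq_one_of_mem_zpowers hz)

theorem le_center [Finite G] (h : IsMinimalNonNilpotent p q b P y) {A : Subgroup G} (hA : A.Normal)
    (hlt : A < P) : A ≤ Subgroup.center G := by
  have hne : Subgroup.zpowers y ⊔ A ≠ ⊤ := fun htop => hlt.not_ge fun x hx => by
    obtain ⟨z, hz, a, ha, rfl⟩ := Subgroup.mem_sup_of_normal_right.1 (htop.ge (Subgroup.mem_top x))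
    have hzP : z ∈ P := (P.mul_mem_cancel_right (hlt.le ha)).1 hx
    rw [Subgroup.disjoint_def.1 h.disjoint hzP hz, one_mul]
    exact ha
  have hcomm : ∀ a ∈ A, Commute a y := fun a ha => by
    obtain ⟨k, hk⟩ := h.exists_pow_eq_one (hlt.le ha)
    exact commute_of_isNilpotent (h.isNilpotent _ hne) h.prime_left h.prime_right h.ne
      (Subgroup.mem_sup_right ha) (Subgroup.mem_sup_left (Subgroup.mem_zpowers y)) hk
      (h.pow_eq_one_of_mem_zpowers (Subgroup.mem_zpowers y))
  by_cases htop : Subgroup.centralizer (A : Set G) = ⊤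
  · intro a ha
    rw [Subgroup.mem_center_iff]
    exact fun g => (Subgroup.mem_centralizer_iff.1 (htop.ge (Subgroup.mem_top g)) a ha).symm
  · obtain ⟨S, hS, hSq, hyS⟩ := exists_normal_isPGroup (h.isNilpotent _ htop) h.prime_right
    have hy := hyS y (Subgroup.mem_centralizer_iff.2 hcomm) b
      (h.pow_eq_one_of_mem_zpowers (Subgroup.mem_zpowers y))
    have := Fact.mk h.prime_left
    have := Fact.mk h.prime_right
    obtain ⟨u, hu, hyu⟩ := h.exists_not_commute
    exact absurd (Subgroup.commute_of_normal_of_disjoint _ _ hS h.normal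
      (IsPGroup.disjoint_of_ne q p h.ne.symm _ _ hSq h.isPGroup) _ _ hy hu) hyu

theorem eq_one_of_conj_eq (h : IsMinimalNonNilpotent p q b P y) {c u : G} (hc : c ∈ P)
    (hc' : c ∈ Subgroup.center G) (hu : y * u * y⁻¹ = c * u) : c = 1 := by
  have key : ∀ k : ℕ, y ^ k * u * (y ^ k)⁻¹ = c ^ k * u := by
    intro k
    induction k with
    | zero => simp
    | succ k ih =>
      calc y ^ (k + 1) * u * (y ^ (k + 1))⁻¹ = y * (y ^ k * u * (y ^ k)⁻¹) * y⁻¹ := by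
            rw [pow_succ']; group
        _ = (y * c ^ k) * u * y⁻¹ := by rw [ih]; group
        _ = c ^ k * (y * u * y⁻¹) := by
            rw [Subgroup.mem_center_iff.1 (pow_mem hc' k) y]; group
        _ = c ^ (k + 1) * u := by rw [hu, pow_succ]; group
  have := key (q ^ b)
  rw [h.pow_eq_one_of_mem_zpowers (Subgroup.mem_zpowers y)] at this
  exact h.eq_one_of_pow_eq_one hc (by simpa using this)

theorem exists_maximal (h : IsMinimalNonNilpotent p q b P y) [Finite G] :
    ∃ M < P, (∀ u ∈ P, u ^ p ∈ M) ∧ ∀ u ∈ P, ∀ v ∈ P, ⁅u, v⁆ ∈ M := by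
  have := Fact.mk h.prime_left
  obtain ⟨k, hk⟩ := IsPGroup.iff_card.1 h.isPGroup
  obtain ⟨u, hu, hyu⟩ := h.exists_not_commute
  obtain _ | k := k
  · rw [pow_zero, Subgroup.card_eq_one] at hk
    rw [hk, Subgroup.mem_bot] at hu
    exact absurd (hu ▸ Commute.one_right y) hyu
  obtain ⟨M, hM⟩ := Sylow.exists_subgroup_card_pow_prime (G := P) p (n := k)
    (hk ▸ pow_dvd_pow p k.le_succ)
  have hindex : M.index = p := by
    have := M.card_mul_index
    rw [hM, hk, pow_succ] at this
    exact Nat.eq_of_mul_eq_mul_left (pow_pos h.prime_left.pos k) this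
  have hMn : M.Normal := Subgroup.normal_of_index_eq_minFac_card
    (by rw [hindex, hk, h.prime_left.pow_minFac k.succ_ne_zero])
  have hcyc : IsCyclic (P ⧸ M) := isCyclic_of_prime_card (p := p) hindex
  have hcomm : commutator P ≤ M :=
    (Subgroup.Normal.quotient_commutative_iff_commutator_le (N := M)).1 hcyc.isMulCommutative
  refine ⟨M.map P.subtype, ?_, fun u hu => ?_, fun u hu v hv => ?_⟩
  · refine lt_of_le_of_ne (Subgroup.map_subtype_le M) fun heq => ?_
    have := congrArg (fun H : Subgroup G => Nat.card H) heq
    simp only [Subgroup.card_subtype] at this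
    rw [hM, hk] at this
    exact absurd (Nat.pow_right_injective h.prime_left.two_le this) k.succ_ne_self.symm
  · exact ⟨⟨u, hu⟩ ^ p, hindex ▸ M.pow_index_mem _, rfl⟩
  · exact ⟨⁅⟨u, hu⟩, ⟨v, hv⟩⁆, hcomm (Subgroup.commutator_mem_commutator (Subgroup.mem_top _)
      (Subgroup.mem_top _)), rfl⟩

theorem mem_center (h : IsMinimalNonNilpotent p q b P y) [Finite G] :
    (∀ u ∈ P, u ^ p ∈ Subgroup.center G) ∧ ∀ u ∈ P, ∀ v ∈ P, ⁅u, v⁆ ∈ Subgroup.center G := by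
  obtain ⟨M, hM, hpow, hcomm⟩ := h.exists_maximal
  have hPn := h.normal
  let s : Set G := {x | (∃ u ∈ P, u ^ p = x) ∨ ∃ u ∈ P, ∃ v ∈ P, ⁅u, v⁆ = x}
  have hsM : Subgroup.closure s ≤ M := by
    rw [Subgroup.closure_le]
    rintro _ (⟨u, hu, rfl⟩ | ⟨u, hu, v, hv, rfl⟩)
    exacts [hpow u hu, hcomm u hu v hv]
  have hsn : (Subgroup.closure s).Normal := by
    rw [← Subgroup.normalizer_eq_top_iff, eq_top_iff, Subgroup.le_normalizer_closure_iff]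
    rintro g - _ (⟨u, hu, rfl⟩ | ⟨u, hu, v, hv, rfl⟩)
    · exact Subgroup.subset_closure (Or.inl ⟨g * u * g⁻¹, hPn.conj_mem u hu g, conj_pow⟩)
    · exact Subgroup.subset_closure (Or.inr ⟨g * u * g⁻¹, hPn.conj_mem u hu g,
        g * v * g⁻¹, hPn.conj_mem v hv g, (conjugate_commutatorElement u v g).symm⟩)
  have hle := h.le_center hsn (hsM.trans_lt hM)
  exact ⟨fun u hu => hle (Subgroup.subset_closure (Or.inl ⟨u, hu, rfl⟩)),
    fun u hu v hv => hle (Subgroup.subset_closure (Or.inr ⟨u, hu, v, hv, rfl⟩))⟩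

theorem mem_center_of_commute (h : IsMinimalNonNilpotent p q b P y) [Finite G] {g x : G}
    (hg : Subgroup.zpowers g ⊔ P = ⊤) (hx : x ∈ P) (hgx : Commute g x) :
    x ∈ Subgroup.center G := by
  have hPn := h.normal
  have hcP : ∀ {u v : G}, u ∈ P → v ∈ P → ⁅u, v⁆ ∈ P := fun hu hv =>
    P.mul_mem (P.mul_mem (P.mul_mem hu hv) (P.inv_mem hu)) (P.inv_mem hv)
  have hconj : ∀ u v : G, u * v * u⁻¹ = ⁅u, v⁆ * v := fun u v => by
    rw [commutatorElement_def]; group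
  let A : Subgroup G := P ⊓ Subgroup.centralizer {g}
  have hmem : ∀ {v}, v ∈ A ↔ v ∈ P ∧ Commute g v := fun {v} => by
    simp only [A, Subgroup.mem_inf, Subgroup.mem_centralizer_singleton_iff]
    exact and_congr_right fun _ => ⟨fun e => e.symm, fun e => e.symm⟩
  have hAn : A.Normal := by
    rw [← Subgroup.normalizer_eq_top_iff, eq_top_iff, ← hg, sup_le_iff, Subgroup.le_normalizer_iff,
      Subgroup.le_normalizer_iff]
    refine ⟨?_, fun u hu v hv => ?_⟩
    · rintro _ ⟨i, rfl⟩ v hv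
      have : Commute (g ^ i) v := (hmem.1 hv).2.zpow_left i
      simpa [this.eq] using hv
    · rw [hconj]
      refine A.mul_mem (hmem.2 ⟨hcP hu (hmem.1 hv).1, ?_⟩) hv
      exact Subgroup.mem_center_iff.1 (h.mem_center.2 u hu v (hmem.1 hv).1) g
  refine h.le_center hAn (lt_of_le_of_ne inf_le_left fun heq => ?_) (hmem.2 ⟨hx, hgx⟩)
  have hall : ∀ v ∈ P, Commute g v := fun v hv => (hmem.1 (heq.ge hv)).2
  obtain ⟨u, hu, hyu⟩ := h.exists_not_commute
  obtain ⟨z, ⟨i, rfl⟩, v, hv, hzv⟩ := Subgroup.mem_sup_of_normal_right.1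
    (hg.ge (Subgroup.mem_top y))
  have hy : y * u * y⁻¹ = ⁅v, u⁆ * u := by
    have : Commute (g ^ i) (v * u * v⁻¹) := (hall _ (hPn.conj_mem u hu v)).zpow_left i
    calc y * u * y⁻¹ = g ^ i * (v * u * v⁻¹) * (g ^ i)⁻¹ := by
          rw [← hzv]
          simp only [mul_inv_rev, mul_assoc]
      _ = ⁅v, u⁆ * u := by rw [this.eq, mul_inv_cancel_right, hconj]
  rw [h.eq_one_of_conj_eq (hcP hv hu) (h.mem_center.2 v hv u hu) hy, one_mul,
    mul_inv_eq_iff_eq_mul] at hy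
  exact hyu hy

theorem pow_eq_one_of_mem_commutator (h : IsMinimalNonNilpotent p q b P y) [Finite G] {x : P}
    (hx : x ∈ commutator P) : (x : G) ^ p = 1 := by
  suffices (x : G) ∈ Subgroup.center G ∧ (x : G) ^ p = 1 from this.2
  rw [commutator_eq_closure] at hx
  induction hx using Subgroup.closure_induction with
  | mem x hx =>
    obtain ⟨u, v, rfl⟩ := hx
    have hc := h.mem_center.2 u u.2 v v.2
    refine ⟨hc, ?_⟩
    have hconj : (u : G) * v * (u : G)⁻¹ = ⁅(u : G), (v : G)⁆ * v := by
      rw [commutatorElement_def]; group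
    have hpow := congrArg (· ^ p) hconj
    simp only [conj_pow] at hpow
    rw [Subgroup.mem_center_iff.1 (h.mem_center.1 v v.2) u, mul_inv_cancel_right,
      Commute.mul_pow (Subgroup.mem_center_iff.1 hc v).symm] at hpow
    exact right_eq_mul.1 hpow
  | one => exact ⟨Subgroup.one_mem _, one_pow p⟩
  | mul a c _ _ ha hc =>
    refine ⟨Subgroup.mul_mem _ ha.1 hc.1, ?_⟩
    rw [Subgroup.coe_mul, Commute.mul_pow (Subgroup.mem_center_iff.1 hc.1 a), ha.2, hc.2, one_mul]
  | inv a _ ha => exact ⟨Subgroup.inv_mem _ ha.1, by rw [Subgroup.coe_inv, inv_pow, ha.2, inv_one]⟩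

theorem pow_eq_one_of_commute (h : IsMinimalNonNilpotent p q b P y) [Finite G] {x : G}
    (hx : x ∈ P) (hyx : Commute y x) : x ^ p = 1 := by
  have hPn := h.normal
  let σ : P →* P := (MulAut.conjNormal y : MulAut P).toMonoidHom
  have hσ : ∀ u : P, (σ u : G) = y * u * y⁻¹ := fun u => MulAut.conjNormal_apply y u
  let f : P →* Abelianization P := Abelianization.of.comp σ / Abelianization.of
  have hf : ∀ u, f u = Abelianization.of (σ u) / Abelianization.of u := fun u => rfl
  let B : Subgroup P := f.range.comap Abelianization.of
  have hσB : ∀ u : P, u ∈ B ↔ σ u ∈ B := fun u => by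
    simp only [B, Subgroup.mem_comap]
    rw [← div_mul_cancel (Abelianization.of (σ u)) (Abelianization.of u), ← hf]
    exact (Subgroup.mul_mem_cancel_left f.range ⟨u, rfl⟩).symm
  have hBn : (B.map P.subtype).Normal := by
    rw [← Subgroup.normalizer_eq_top_iff, eq_top_iff, ← h.sup_eq_top, sup_le_iff,
      Subgroup.zpowers_le, Subgroup.le_normalizer_iff]
    constructor
    · rw [Subgroup.mem_normalizer_iff]
      intro v
      constructor
      · rintro ⟨u, hu, rfl⟩
        exact ⟨σ u, (hσB u).1 hu, hσ u⟩
      · rintro ⟨w, hw, hwv⟩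
        have hv : v ∈ P := by
          have := hPn.conj_mem _ w.2 y⁻¹
          rw [show (w : G) = y * v * y⁻¹ from hwv] at this
          simpa [mul_assoc] using this
        refine ⟨⟨v, hv⟩, (hσB _).2 ?_, rfl⟩
        have hvw : σ ⟨v, hv⟩ = w := Subtype.ext ((hσ _).trans hwv.symm)
        rw [hvw]
        exact hw
    · rintro u hu _ ⟨v, hv, rfl⟩
      refine ⟨⟨u, hu⟩ * v * ⟨u, hu⟩⁻¹, ?_, rfl⟩
      have : B.Normal := inferInstance
      exact this.conj_mem v hv _
  have hBtop : B = ⊤ := by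
    by_contra hne
    have hlt : B.map P.subtype < P := by
      refine lt_of_le_of_ne (Subgroup.map_subtype_le B) fun heq => hne ?_
      rw [eq_top_iff]
      intro u _
      obtain ⟨v, hv, hvu⟩ := heq.ge u.2
      rwa [← Subtype.ext hvu]
    obtain ⟨u, hu, hyu⟩ := h.exists_not_commute
    let c : P := σ ⟨u, hu⟩ / ⟨u, hu⟩
    have hcB : c ∈ B := by
      refine ⟨⟨u, hu⟩, ?_⟩
      rw [hf, ← map_div]
    have hcu : y * u * y⁻¹ = c * u := by
      simp [c, hσ]
    have hc := h.le_center hBn hlt ⟨c, hcB, rfl⟩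
    rw [h.eq_one_of_conj_eq c.2 hc hcu, one_mul, mul_inv_eq_iff_eq_mul] at hcu
    exact hyu hcu
  have hsurj : Function.Surjective (Abelianization.lift f) := by
    intro z
    obtain ⟨u, rfl⟩ := QuotientGroup.mk_surjective z
    obtain ⟨v, hv⟩ : u ∈ B := hBtop ▸ Subgroup.mem_top u
    exact ⟨Abelianization.of v, (Abelianization.lift_apply_of f v).trans hv⟩
  have hinj := Finite.injective_iff_surjective.2 hsurj
  have hσx : σ ⟨x, hx⟩ = ⟨x, hx⟩ := Subtype.ext (by rw [hσ]; simp [hyx.eq])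
  have h1 : Abelianization.of (⟨x, hx⟩ : P) = 1 := hinj (by
    rw [Abelianization.lift_apply_of, hf, hσx, div_self', map_one])
  exact h.pow_eq_one_of_mem_commutator (x := ⟨x, hx⟩) ((QuotientGroup.eq_one_iff _).1 h1)

theorem ne_zero (h : IsMinimalNonNilpotent p q b P y) : b ≠ 0 := by
  rintro rfl
  obtain ⟨u, -, hyu⟩ := h.exists_not_commute
  have hy := h.orderOf_eq
  rw [pow_zero, orderOf_eq_one_iff] at hy
  exact hyu (hy ▸ Commute.one_left u)

theorem isComplement' (h : IsMinimalNonNilpotent p q b P y) :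
    P.IsComplement' (Subgroup.zpowers y) := by
  have := h.normal
  refine Subgroup.isComplement'_of_disjoint_and_mul_eq_univ h.disjoint ?_
  rw [← Subgroup.normal_mul, sup_comm, h.sup_eq_top, Subgroup.coe_top]

theorem index_eq (h : IsMinimalNonNilpotent p q b P y) : P.index = q ^ b := by
  rw [h.isComplement'.symm.index_eq_card, Nat.card_zpowers, h.orderOf_eq]

theorem pow_mem (h : IsMinimalNonNilpotent p q b P y) (g : G) : g ^ q ^ b ∈ P := by
  have := h.normal
  exact h.index_eq ▸ P.pow_index_mem g

theorem coprime_card [Finite G] (h : IsMinimalNonNilpotent p q b P y) (j : ℕ) :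
    (Nat.card P).Coprime (q ^ j) := by
  have := Fact.mk h.prime_left
  obtain ⟨k, hk⟩ := IsPGroup.iff_card.1 h.isPGroup
  exact hk ▸ h.coprime_pow k j

theorem sup_eq_top_of_dvd [Finite G] (h : IsMinimalNonNilpotent p q b P y) {g : G}
    (hg : q ^ b ∣ orderOf g) : Subgroup.zpowers g ⊔ P = ⊤ := by
  refine Subgroup.eq_top_of_le_card _ (Nat.le_of_dvd Nat.card_pos ?_)
  rw [← P.card_mul_index, h.index_eq]
  refine (h.coprime_card b).mul_dvd_of_dvd_of_dvd (Subgroup.card_dvd_of_le le_sup_right) ?_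
  rw [← Nat.card_zpowers] at hg
  exact hg.trans (Subgroup.card_dvd_of_le le_sup_left)

theorem pow_mem_center [Finite G] (h : IsMinimalNonNilpotent p q b P y) {g : G}
    (hg : q ^ b ∣ orderOf g) : g ^ q ^ b ∈ Subgroup.center G :=
  h.mem_center_of_commute (h.sup_eq_top_of_dvd hg) (h.pow_mem g) (Commute.self_pow g _)

theorem nontrivial (h : IsMinimalNonNilpotent p q b P y) : Nontrivial P := by
  obtain ⟨u, hu, hyu⟩ := h.exists_not_commute
  refine ⟨⟨u, hu⟩, 1, fun heq => hyu ?_⟩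
  rw [show u = 1 from congrArg Subtype.val heq]
  exact Commute.one_right y

theorem exponent_eq [Finite G] (h : IsMinimalNonNilpotent p q b P y) {a : G}
    (ha : orderOf a = Monoid.exponent G) : Monoid.exponent G = q ^ b * p := by
  have hn : q ^ b ∣ orderOf a := ha ▸ h.orderOf_eq ▸ Monoid.order_dvd_exponent y
  refine Nat.dvd_antisymm ?_ ?_
  · rw [← ha, orderOf_dvd_iff_pow_eq_one, pow_mul]
    exact h.pow_eq_one_of_commute (h.pow_mem a)
      (Subgroup.mem_center_iff.1 (h.pow_mem_center hn) y)
  · have hcop := h.coprime_pow 1 b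
    rw [pow_one] at hcop
    refine hcop.symm.mul_dvd_of_dvd_of_dvd (ha ▸ hn) ?_
    have := h.nontrivial
    obtain ⟨u, hu⟩ := exists_ne (1 : P)
    have := Fact.mk h.prime_left
    obtain ⟨k, hk⟩ := h.isPGroup u
    obtain ⟨j, -, hj⟩ := (Nat.dvd_prime_pow h.prime_left).1 (orderOf_dvd_of_pow_eq_one hk)
    have hj0 : j ≠ 0 := by
      rintro rfl
      exact hu (orderOf_eq_one_iff.1 hj)
    refine (hj ▸ dvd_pow_self p hj0 : p ∣ orderOf u).trans ?_
    rw [← Subgroup.orderOf_coe]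
    exact Monoid.order_dvd_exponent (u : G)

theorem pow_eq_one [Finite G] (h : IsMinimalNonNilpotent p q b P y) {a : G}
    (ha : orderOf a = Monoid.exponent G) {u : G} (hu : u ∈ P) : u ^ p = 1 := by
  refine h.eq_one_of_pow_eq_one (P.pow_mem hu p) (j := b) ?_
  rw [← pow_mul, mul_comm, ← h.exponent_eq ha, Monoid.pow_exponent_eq_one]

theorem pow_mem_iff (h : IsMinimalNonNilpotent p q b P y) {x z : G} (hx : x ∈ P) (j : ℕ) :
    (x * z) ^ j ∈ P ↔ z ^ j ∈ P := by
  have := h.normal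
  rw [← QuotientGroup.eq_one_iff, ← QuotientGroup.eq_one_iff, QuotientGroup.mk_pow,
    QuotientGroup.mk_pow, QuotientGroup.mk_mul, (QuotientGroup.eq_one_iff x).2 hx, one_mul]

theorem dvd_orderOf_mul_iff [Finite G] (h : IsMinimalNonNilpotent p q b P y) {x z : G}
    (hx : x ∈ P) (hz : z ∈ Subgroup.zpowers y) :
    q ^ b ∣ orderOf (x * z) ↔ orderOf z = q ^ b := by
  constructor
  · intro hd
    refine Nat.dvd_antisymm (orderOf_dvd_of_pow_eq_one (h.pow_eq_one_of_mem_zpowers hz)) ?_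
    have hmem : (x * z) ^ orderOf z ∈ P := by
      rw [h.pow_mem_iff hx, pow_orderOf_eq_one]
      exact P.one_mem
    have hpow : (x * z) ^ (orderOf z * Nat.card P) = 1 := by
      rw [pow_mul]
      exact congrArg Subtype.val (pow_card_eq_one' (x := (⟨_, hmem⟩ : P)))
    exact (h.coprime_card b).symm.dvd_of_dvd_mul_right
      (hd.trans (orderOf_dvd_of_pow_eq_one hpow))
  · intro ho
    rw [← ho, orderOf_dvd_iff_pow_eq_one]
    refine Subgroup.disjoint_def.1 h.disjoint ?_ (Subgroup.pow_mem _ hz _)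
    rw [← h.pow_mem_iff hx, pow_orderOf_eq_one]
    exact P.one_mem

theorem card_dvd_orderOf [Finite G] (h : IsMinimalNonNilpotent p q b P y) :
    Nat.card {g : G // q ^ b ∣ orderOf g} = Nat.card P * (q ^ b).totient := by
  have hcard : Nat.card (Subgroup.zpowers y) = q ^ b := by rw [Nat.card_zpowers, h.orderOf_eq]
  rw [← hcard, ← card_orderOf_eq_totient, ← Nat.card_prod]
  symm
  let e : P × Subgroup.zpowers y ≃ G := Equiv.ofBijective _ h.isComplement'
  refine Nat.card_congr (Equiv.trans ?_ (e.subtypeEquiv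
    (p := fun x => orderOf x.2 = Nat.card (Subgroup.zpowers y)) fun x => ?_))
  · exact ⟨fun x => ⟨(x.1, x.2), x.2.2⟩, fun x => (x.1.1, ⟨x.1.2, x.2⟩), fun _ => rfl, fun _ => rfl⟩
  · rw [hcard, ← Subgroup.orderOf_coe]
    exact (h.dvd_orderOf_mul_iff x.1.2 x.2.2).symm

theorem card_orderOf_mul_card [Finite G] (h : IsMinimalNonNilpotent p q b P y) {a : G}
    (ha : orderOf a = Monoid.exponent G) :
    Nat.card {t : G // orderOf t = q ^ b} * Nat.card (P ⊓ Subgroup.center G : Subgroup G) =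
      Nat.card P * (q ^ b).totient := by
  rw [← h.card_dvd_orderOf, ← Nat.card_prod]
  have hcomm : ∀ (c : (P ⊓ Subgroup.center G : Subgroup G)) (g : G), Commute g c :=
    fun c g => Subgroup.mem_center_iff.1 c.2.2 g
  have hinj : ∀ c d : (P ⊓ Subgroup.center G : Subgroup G),
      (c : G) ^ q ^ b = (d : G) ^ q ^ b → c = d := by
    intro c d hcd
    refine Subtype.ext (mul_inv_eq_one.1 (h.eq_one_of_pow_eq_one (j := b)
      (P.mul_mem c.2.1 (P.inv_mem d.2.1)) ?_))
    rw [(hcomm d c).inv_right.mul_pow, inv_pow, hcd, mul_inv_cancel]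
  let f : {t : G // orderOf t = q ^ b} × (P ⊓ Subgroup.center G : Subgroup G) →
      {g : G // q ^ b ∣ orderOf g} := fun x => ⟨x.1 * x.2, by
    obtain ⟨j, hj⟩ := h.exists_pow_eq_one x.2.2.1
    rw [(hcomm x.2 x.1).orderOf_mul_eq_mul_orderOf_of_coprime, x.1.2]
    · exact dvd_mul_right _ _
    · rw [x.1.2]
      exact (h.coprime_pow j b).symm.coprime_dvd_right (orderOf_dvd_of_pow_eq_one hj)⟩
  refine Nat.card_congr (Equiv.ofBijective f ⟨?_, ?_⟩)
  · rintro ⟨⟨t, ht⟩, c⟩ ⟨⟨s, hs⟩, d⟩ heq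
    have heq' : t * c = s * d := congrArg Subtype.val heq
    have hpow := congrArg (· ^ q ^ b) heq'
    simp only [(hcomm _ _).mul_pow] at hpow
    rw [← ht, pow_orderOf_eq_one, ht, ← hs, pow_orderOf_eq_one, hs, one_mul, one_mul] at hpow
    obtain rfl := hinj c d hpow
    obtain rfl := mul_right_cancel heq'
    rfl
  · rintro ⟨g, hg⟩
    obtain ⟨c, hc⟩ := Finite.surjective_of_injective
      (f := fun c : (P ⊓ Subgroup.center G : Subgroup G) => c ^ q ^ b)
      (fun c d hcd => hinj c d (congrArg Subtype.val hcd))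
      ⟨g ^ q ^ b, h.pow_mem g, h.pow_mem_center hg⟩
    have hc' : (c : G) ^ q ^ b = g ^ q ^ b := congrArg Subtype.val hc
    have hgc : Commute g (c : G)⁻¹ := (hcomm c g).inv_right
    refine ⟨⟨⟨g * (c : G)⁻¹, Nat.dvd_antisymm ?_ ?_⟩, c⟩, ?_⟩
    · rw [orderOf_dvd_iff_pow_eq_one, hgc.mul_pow, inv_pow, hc', mul_inv_cancel]
    · have hpow : g ^ (orderOf (g * (c : G)⁻¹) * p) = 1 := by
        have h1 := pow_orderOf_eq_one (g * (c : G)⁻¹)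
        rw [hgc.mul_pow, inv_pow, mul_inv_eq_one] at h1
        rw [pow_mul, h1, ← pow_mul, mul_comm, pow_mul, h.pow_eq_one ha c.2.1, one_pow]
      have hcop := h.coprime_pow 1 b
      rw [pow_one] at hcop
      exact hcop.symm.dvd_of_dvd_mul_right (hg.trans (orderOf_dvd_of_pow_eq_one hpow))
    · exact Subtype.ext (inv_mul_cancel_right g (c : G))

theorem phi_add_card [Finite G] (h : IsMinimalNonNilpotent p q b P y) {a : G}
    (ha : orderOf a = Monoid.exponent G) :
    phi G + Nat.card {t : G // orderOf t = q ^ b} = Nat.card {g : G // q ^ b ∣ orderOf g} := by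
  classical
  have hpos : 0 < q ^ b := pow_pos h.prime_right.pos b
  rw [phi, ← Nat.card_sum]
  refine Nat.card_congr ((subtypeOrEquiv _ _ ?_).symm.trans (Equiv.subtypeEquivRight fun g => ?_))
  · rw [Pi.disjoint_iff]
    intro g
    rw [Prop.disjoint_iff]
    rintro ⟨h1, h2⟩
    rw [h1, h.exponent_eq ha] at h2
    exact h.prime_left.ne_one (mul_eq_left₀ hpos.ne' |>.1 h2)
  · have hg := Monoid.order_dvd_exponent g
    rw [h.exponent_eq ha] at hg ⊢
    constructor
    · rintro (ho | ho)
      · exact ho ▸ dvd_mul_right _ _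
      · exact ho.symm.dvd
    · rintro ⟨k, hk⟩
      rw [hk] at hg ⊢
      obtain rfl | rfl := (Nat.dvd_prime h.prime_left).1 (Nat.dvd_of_mul_dvd_mul_left hpos hg)
      · exact Or.inr (mul_one _)
      · exact Or.inl rfl

theorem exists_card_eq_mul [Finite G] (h : IsMinimalNonNilpotent p q b P y) :
    ∃ k, Nat.card P = Nat.card (P ⊓ Subgroup.center G : Subgroup G) * k ∧ k ≠ 1 ∧ q ∣ k - 1 := by
  have hn := h.normal
  have := Fact.mk h.prime_right
  obtain ⟨k, hk⟩ := Subgroup.card_dvd_of_le (inf_le_left : P ⊓ Subgroup.center G ≤ P)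
  refine ⟨k, hk, ?_, ?_⟩
  · rintro rfl
    obtain ⟨u, hu, hyu⟩ := h.exists_not_commute
    have heq := Subgroup.eq_of_le_of_card_ge (inf_le_left : P ⊓ Subgroup.center G ≤ P)
      (hk.trans (mul_one _)).le
    exact hyu (Subgroup.mem_center_iff.1 (heq.ge hu).2 y)
  · have hq : IsPGroup q (Subgroup.zpowers y) :=
      IsPGroup.of_card (n := b) (by rw [Nat.card_zpowers, h.orderOf_eq])
    let act : MulAction (Subgroup.zpowers y) P := MulAction.compHom P
      ((MulAut.conjNormal (H := P)).comp (Subgroup.zpowers y).subtype)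
    have hact : ∀ (z : Subgroup.zpowers y) (u : P), ((z • u : P) : G) = z * u * (z : G)⁻¹ :=
      fun z u => MulAut.conjNormal_apply (z : G) u
    have hmod := hq.card_modEq_card_fixedPoints P
    have hfix : Nat.card (MulAction.fixedPoints (Subgroup.zpowers y) P) =
        Nat.card (P ⊓ Subgroup.center G : Subgroup G) := by
      refine Nat.card_congr ⟨fun u => ⟨u.1, u.1.2, ?_⟩, fun c => ⟨⟨c, c.2.1⟩, fun z => ?_⟩,
        fun _ => rfl, fun _ => rfl⟩
      · refine h.mem_center_of_commute h.sup_eq_top u.1.2 ?_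
        have := congrArg Subtype.val (u.2 ⟨y, Subgroup.mem_zpowers y⟩)
        rw [hact, mul_inv_eq_iff_eq_mul] at this
        exact this
      · refine Subtype.ext ?_
        rw [hact, mul_inv_eq_iff_eq_mul]
        exact Subgroup.mem_center_iff.1 c.2.2 z
    rw [hfix, hk] at hmod
    have hcop : (Nat.card (P ⊓ Subgroup.center G : Subgroup G)).Coprime q := by
      have := h.coprime_card 1
      rw [pow_one] at this
      exact this.coprime_dvd_left (Subgroup.card_dvd_of_le inf_le_left)
    have hk1 : k ≡ 1 [MOD q] := by
      refine Nat.ModEq.cancel_left_of_coprime (Nat.coprime_comm.1 hcop) ?_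
      rwa [mul_one]
    have hkpos : 1 ≤ k := Nat.one_le_iff_ne_zero.2 fun h0 => by
      rw [h0, mul_zero] at hk
      exact Nat.card_pos.ne' hk
    exact (Nat.modEq_iff_dvd' hkpos).1 hk1.symm

theorem sup_zpowers_pow_ne_top (h : IsMinimalNonNilpotent p q b P y) :
    P ⊔ Subgroup.zpowers (y ^ q) ≠ ⊤ := by
  have := h.normal
  intro htop
  obtain ⟨x, hx, _, ⟨i, rfl⟩, hxi⟩ := Subgroup.mem_sup_of_normal_left.1
    (htop.ge (Subgroup.mem_top y))
  have hx' : x = y ^ (1 - (q : ℤ) * i) := by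
    rw [zpow_sub, zpow_one, zpow_mul, zpow_natCast]
    exact eq_mul_inv_of_mul_eq hxi
  have h1 : y ^ (1 - (q : ℤ) * i) = 1 :=
    Subgroup.disjoint_def.1 h.disjoint (hx' ▸ hx) ⟨_, rfl⟩
  rw [← orderOf_dvd_iff_zpow_eq_one, h.orderOf_eq] at h1
  have hq : (q : ℤ) ∣ 1 - q * i :=
    (Int.natCast_dvd_natCast.2 (dvd_pow_self q h.ne_zero)).trans h1
  have hq1 : (q : ℤ) ∣ 1 := (Int.dvd_iff_dvd_of_dvd_sub hq).2 (dvd_mul_right _ _)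
  exact h.prime_right.one_lt.ne' (Nat.dvd_one.1 (by exact_mod_cast hq1))

theorem phi_sup_zpowers_pow [Finite G] (h : IsMinimalNonNilpotent p q b P y) {a : G}
    (ha : orderOf a = Monoid.exponent G) :
    phi (P ⊔ Subgroup.zpowers (y ^ q) : Subgroup G) =
      (Nat.card P - 1) * (q ^ (b - 1)).totient := by
  have hcard : Nat.card (Subgroup.zpowers (y ^ q)) = q ^ (b - 1) := by
    rw [Nat.card_zpowers, orderOf_pow_of_dvd h.prime_right.ne_zero
      (h.orderOf_eq ▸ dvd_pow_self q h.ne_zero), h.orderOf_eq]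
    exact (Nat.pow_sub_one h.prime_right.ne_zero h.ne_zero).symm
  have hcomm : ∀ u ∈ P, ∀ z ∈ Subgroup.zpowers (y ^ q), Commute u z := by
    rintro u hu z hz
    obtain ⟨k, hk⟩ := h.exists_pow_eq_one hu
    exact commute_of_isNilpotent (h.isNilpotent _ h.sup_zpowers_pow_ne_top) h.prime_left
      h.prime_right h.ne (Subgroup.mem_sup_left hu) (Subgroup.mem_sup_right hz) hk
      (h.pow_eq_one_of_mem_zpowers (Subgroup.zpowers_le.2 (Subgroup.npow_mem_zpowers y q) hz))
  have := h.nontrivial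
  rw [phi_sup hcomm (hcard ▸ h.coprime_card (b - 1)),
    phi_of_isCyclic (G := Subgroup.zpowers (y ^ q)),
    hcard,    phi_of_pow_prime_eq_one h.prime_left fun x => Subtype.ext (h.pow_eq_one ha x.2)]

theorem not_phi_dvd [Finite G] (h : IsMinimalNonNilpotent p q b P y) (hG : phi G ≠ 0) :
    ¬ phi (P ⊔ Subgroup.zpowers (y ^ q) : Subgroup G) ∣ phi G := by
  intro hdvd
  obtain ⟨⟨a, ha⟩⟩ := (Nat.card_ne_zero.1 hG).1
  obtain ⟨k, hk, hk1, hqk⟩ := h.exists_card_eq_mul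
  rw [h.phi_sup_zpowers_pow ha] at hdvd
  have hmul := h.card_orderOf_mul_card ha
  have hadd := h.phi_add_card ha
  rw [h.card_dvd_orderOf, ← hmul] at hadd
  obtain ⟨t, ht0, htq, ht⟩ : ∃ t, 0 < t ∧ t ≤ q ∧
      (q ^ b).totient = t * (q ^ (b - 1)).totient := by
    have hb : q ^ b = q * q ^ (b - 1) := (mul_pow_sub_one h.ne_zero q).symm
    rw [hb]
    by_cases hq : q ∣ q ^ (b - 1)
    · exact ⟨q, h.prime_right.pos, le_rfl, Nat.totient_mul_of_prime_of_dvd h.prime_right hq⟩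
    · exact ⟨q - 1, Nat.sub_pos_of_lt h.prime_right.one_lt, Nat.sub_le q 1,
        Nat.totient_mul_of_prime_of_not_dvd h.prime_right hq⟩
  have hm : 0 < (q ^ (b - 1)).totient := Nat.totient_pos.2 (pow_pos h.prime_right.pos _)
  have hA : 0 < Nat.card P := Nat.card_pos
  have hc : 0 < Nat.card (P ⊓ Subgroup.center G : Subgroup G) := Nat.card_pos
  rw [ht] at hmul
  generalize Nat.card (P ⊓ Subgroup.center G : Subgroup G) = c at *
  generalize Nat.card {t : G // orderOf t = q ^ b} = T at *
  generalize (q ^ (b - 1)).totient = m at *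
  generalize Nat.card P = A at *
  obtain ⟨c, rfl⟩ := Nat.exists_eq_add_of_lt hc
  obtain ⟨A, rfl⟩ := Nat.exists_eq_add_of_lt hA
  simp only [zero_add, Nat.add_sub_cancel] at *
  have hphi : phi G = T * c := by linarith
  have hc0 : c ≠ 0 := by
    rintro rfl
    exact hG hphi
  have h1 : A * m ∣ (A + 1) * (t * c) * m :=
    (hdvd.mul_right (c + 1)).trans (dvd_of_eq (by rw [hphi]; linear_combination c * hmul))
  have h2 : A ∣ t * c :=
    (Nat.coprime_self_add_right.2 (Nat.coprime_one_right A)).dvd_of_dvd_mul_left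
      (Nat.dvd_of_mul_dvd_mul_right hm h1)
  have hle := Nat.le_of_dvd (Nat.mul_pos ht0 (Nat.pos_of_ne_zero hc0)) h2
  obtain _ | _ | k := k
  · simp at hk
  · exact hk1 rfl
  have hqle := Nat.le_of_dvd (by simp) hqk
  simp only [Nat.add_sub_cancel] at hqle
  nlinarith [Nat.mul_le_mul_right c (htq.trans hqle)]

end IsMinimalNonNilpotent

theorem stmt_4 (G : Type*) [Group G] [Finite G]
    (hne : ∀ S : Subgroup G, phi S ≠ 0)
    (hdvd : ∀ H K : Subgroup G, H ≤ K → phi H ∣ phi K) :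
    Group.IsNilpotent G := by
  suffices ∀ H : Subgroup G, Group.IsNilpotent H from
    (Group.isNilpotent_congr Subgroup.topEquiv).1 (this ⊤)
  intro H
  induction H using WellFoundedLT.induction with
  | ind H ih =>
    by_contra hH
    have hmap : ∀ K : Subgroup H, phi (K.map H.subtype) = phi K := fun K =>
      (phi_congr (K.equivMapOfInjective _ H.subtype_injective)).symm
    have hproper : ∀ K : Subgroup H, K ≠ ⊤ → Group.IsNilpotent K := fun K hK => by
      have hlt : K.map H.subtype < H := by
        refine lt_of_le_of_ne (Subgroup.map_subtype_le K) fun heq => hK ?_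
        refine Subgroup.map_injective H.subtype_injective ?_
        rw [heq, ← MonoidHom.range_eq_map, H.range_subtype]
      have := ih _ hlt
      exact (Group.isNilpotent_congr (K.equivMapOfInjective _ H.subtype_injective)).2 this
    obtain ⟨p, q, b, hp, hq, hpq, P, y, hPn, hP, hy, hyP, hu⟩ :=
      exists_structure_of_minimal_not_isNilpotent hproper hH
    have h : IsMinimalNonNilpotent p q b P y := ⟨hproper, hp, hq, hpq, hPn, hP, hy, hyP, hu⟩
    refine h.not_phi_dvd (hne H) ?_
    rw [← hmap]
    exact hdvd _ _ (Subgroup.map_subtype_le _)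
end

section
/- Let p be a prime and let G be a finite abelian p-group such that for all subgroups H, K of G with H ⊆ K, φ(H) divides φ(K). Then G is cyclic or isomorphic to ℤ_p × ℤ_p. -/
theorem phi_add_card_pow_eq_one {G : Type*} [Group G] [Finite G] {p k : ℕ} [Fact p.Prime]
    (h : Monoid.exponent G = p ^ (k + 1)) :
    phi G + Nat.card {a : G // a ^ p ^ k = 1} = Nat.card G := by
  classical
  have hiff (a : G) : orderOf a = Monoid.exponent G ↔ ¬ a ^ p ^ k = 1 := by
    rw [h]
    refine ⟨fun ha hp ↦ ?_, fun ha ↦ orderOf_eq_prime_pow ha (h ▸ Monoid.pow_exponent_eq_one a)⟩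
    have hlt : p ^ k < p ^ (k + 1) :=
      Nat.pow_lt_pow_right (Fact.out : p.Prime).one_lt k.lt_succ_self
    exact absurd (orderOf_le_of_pow_eq_one (pow_pos (Fact.out : p.Prime).pos k) hp) (by omega)
  rw [phi, Nat.card_congr (Equiv.subtypeEquivRight hiff), ← Nat.card_sum,
    Nat.card_congr ((Equiv.sumComm _ _).trans (Equiv.sumCompl fun a : G ↦ a ^ p ^ k = 1))]

theorem phi_eq_card_sub_one {G : Type*} [Group G] [Finite G] [Nontrivial G] {p : ℕ} [Fact p.Prime]
    (h : ∀ a : G, a ^ p = 1) : phi G = Nat.card G - 1 := by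
  have hexp : Monoid.exponent G = p ^ (0 + 1) := by
    rw [zero_add, pow_one]
    refine ((Nat.dvd_prime Fact.out).1 (Monoid.exponent_dvd_of_forall_pow_eq_one h)).resolve_left ?_
    rw [Monoid.exp_eq_one_iff]
    exact not_subsingleton G
  have := phi_add_card_pow_eq_one hexp
  simp only [pow_zero, pow_one, Nat.card_unique] at this
  omega

theorem card_ker_powMonoidHom_pow_le {G : Type*} [CommGroup G] [Finite G] {p : ℕ}
    (h : Nat.card (powMonoidHom p : G →* G).ker ≤ p) (k : ℕ) :
    Nat.card (powMonoidHom (p ^ k) : G →* G).ker ≤ p ^ k := by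
  induction k with
  | zero =>
    have : (powMonoidHom (p ^ 0) : G →* G).ker = ⊥ := by ext; simp [MonoidHom.mem_ker]
    rw [this]; simp
  | succ k ih =>
    set K := (powMonoidHom (p ^ (k + 1)) : G →* G).ker with hK
    let g : K →* G := (powMonoidHom p).comp K.subtype
    have hrange : g.range ≤ (powMonoidHom (p ^ k) : G →* G).ker := by
      rintro _ ⟨⟨x, hx⟩, rfl⟩
      simpa [g, hK, MonoidHom.mem_ker, ← pow_mul, pow_succ'] using hx
    have hker : g.ker.map K.subtype ≤ (powMonoidHom p : G →* G).ker := by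
      rintro _ ⟨x, hx, rfl⟩
      exact hx
    have hker' : Nat.card g.ker ≤ p := by
      rw [← Subgroup.card_map_of_injective (f := K.subtype) K.subtype_injective]
      exact (Subgroup.card_le_of_le hker).trans h
    calc Nat.card K = Nat.card g.ker * Nat.card g.range := by
          rw [← Subgroup.index_ker, Subgroup.card_mul_index]
      _ ≤ p * p ^ k := Nat.mul_le_mul hker' ((Subgroup.card_le_of_le hrange).trans ih)
      _ = p ^ (k + 1) := (pow_succ' p k).symm

theorem IsPGroup.isCyclic_of_card_ker_powMonoidHom_le {G : Type*} [CommGroup G] [Finite G] {p : ℕ}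
    [Fact p.Prime] (hG : IsPGroup p G) (h : Nat.card (powMonoidHom p : G →* G).ker ≤ p) :
    IsCyclic G := by
  classical
  have := Fintype.ofFinite G
  refine isCyclic_of_card_pow_eq_one_le fun n hn ↦ ?_
  obtain ⟨m, hm⟩ := hG.exists_card_eq
  obtain ⟨k, -, hk⟩ := (Nat.dvd_prime_pow Fact.out).1 (hm ▸ Nat.gcd_dvd_right n (Nat.card G))
  have hset : (Finset.univ.filter fun a : G ↦ a ^ n = 1).card =
      Nat.card (powMonoidHom (p ^ k) : G →* G).ker := by
    rw [← Fintype.card_subtype, ← Nat.card_eq_fintype_card]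
    refine Nat.card_congr (Equiv.subtypeEquivRight fun a ↦ ?_)
    rw [MonoidHom.mem_ker, powMonoidHom_apply, ← hk, ← hm, ← orderOf_dvd_iff_pow_eq_one,
      ← orderOf_dvd_iff_pow_eq_one, Nat.dvd_gcd_iff]
    exact (and_iff_left (orderOf_dvd_natCard a)).symm
  rw [hset]
  exact (card_ker_powMonoidHom_pow_le h k).trans
    (hk ▸ Nat.le_of_dvd hn (Nat.gcd_dvd_left _ _))

theorem nonempty_mulEquiv_prod_zmod {G : Type*} [CommGroup G] [Finite G] {p : ℕ} [Fact p.Prime]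
    (h : ∀ a : G, a ^ p = 1) (hcard : Nat.card G = p ^ 2) :
    Nonempty (G ≃* (Multiplicative (ZMod p) × Multiplicative (ZMod p))) := by
  let _ : Module (ZMod p) (Additive G) := AddCommGroup.zmodModule (n := p) fun x ↦ h x.toMul
  have hfin : Module.finrank (ZMod p) (Additive G) = 2 := by
    have := Module.natCard_eq_pow_finrank (K := ZMod p) (V := Additive G)
    rw [Nat.card_zmod] at this
    exact Nat.pow_right_injective (Fact.out : p.Prime).two_le (this.symm.trans hcard)
  let e : Additive G ≃ₗ[ZMod p] ZMod p × ZMod p :=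
    LinearEquiv.ofFinrankEq _ _ (by simp [hfin])
  exact ⟨(AddEquiv.toMultiplicative e.toAddEquiv : Multiplicative (Additive G) ≃* _).trans
    (MulEquiv.prodMultiplicative _ _)⟩

theorem sq_sub_one_not_dvd_cube_sub_one {p : ℕ} (hp : 2 ≤ p) : ¬ p ^ 2 - 1 ∣ p ^ 3 - 1 := by
  intro h
  have h1 : p ^ 3 - 1 = p * (p ^ 2 - 1) + (p - 1) := by
    obtain ⟨q, rfl⟩ := Nat.exists_eq_add_of_le hp
    zify [Nat.one_le_pow 3 (2 + q) (by omega), Nat.one_le_pow 2 (2 + q) (by omega),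
      show 1 ≤ 2 + q by omega]
    ring
  rw [h1, Nat.dvd_add_right (Dvd.intro_left _ rfl)] at h
  have h2 := Nat.le_of_dvd (by omega) h
  have h3 : p * 2 ≤ p ^ 2 := by nlinarith
  omega

theorem sq_sub_one_not_dvd_cube_sub_sq {p : ℕ} (hp : 2 ≤ p) : ¬ p ^ 2 - 1 ∣ p ^ 3 - p ^ 2 := by
  intro h
  have h1 : p ^ 3 - p ^ 2 = p ^ 2 * (p - 1) := by rw [Nat.mul_sub]; ring_nf
  have hcop : Nat.Coprime (p ^ 2 - 1) (p ^ 2) := by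
    refine (Nat.coprime_self_sub_left ?_).2 ?_
    · exact Nat.one_le_pow 2 p (by omega)
    · simp
  rw [h1] at h
  have h2 := Nat.le_of_dvd (by omega) (hcop.dvd_of_dvd_mul_left h)
  have h3 : p * 2 ≤ p ^ 2 := by nlinarith
  omega

theorem stmt_5 (p : ℕ) [Fact p.Prime] (G : Type*) [CommGroup G] [Finite G]
    (hG : IsPGroup p G)
    (hdvd : ∀ H K : Subgroup G, H ≤ K → phi H ∣ phi K) :
    IsCyclic G ∨
      Nonempty (G ≃* (Multiplicative (ZMod p) × Multiplicative (ZMod p))) := by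
  have hp : p.Prime := Fact.out
  set V := (powMonoidHom p : G →* G).ker with hV
  have hmem (a : G) : a ∈ V ↔ a ^ p = 1 := Iff.rfl
  obtain ⟨r, hr⟩ := (hG.to_subgroup V).exists_card_eq
  obtain ⟨m, hm⟩ := hG.exists_card_eq
  have hphi {H : Subgroup G} {k : ℕ} (hH : H ≤ V) (hc : Nat.card H = p ^ (k + 1)) :
      phi H = p ^ (k + 1) - 1 := by
    have : Nontrivial H := Finite.one_lt_card_iff_nontrivial.1
      (hc ▸ Nat.one_lt_pow (by omega) hp.one_lt)
    rw [phi_eq_card_sub_one (p := p) fun a ↦ Subtype.ext ((hmem a).1 (hH a.2)), hc]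
  rcases Nat.lt_trichotomy r 2 with h | rfl | h
  · refine .inl (hG.isCyclic_of_card_ker_powMonoidHom_le ?_)
    rw [← hV, hr]
    exact (Nat.pow_le_pow_right hp.pos (by omega : r ≤ 1)).trans_eq (pow_one p)
  · have hVG : p ^ 2 ∣ p ^ m := hr ▸ hm ▸ V.card_subgroup_dvd_card
    have h2m : 2 ≤ m := (Nat.pow_dvd_pow_iff_le_right hp.one_lt).1 hVG
    rcases h2m.eq_or_lt with rfl | hlt
    · have htop : V = ⊤ := Subgroup.eq_top_of_card_eq V (hr.trans hm.symm)
      exact .inr (nonempty_mulEquiv_prod_zmod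
        (fun a ↦ (hmem a).1 (htop ▸ Subgroup.mem_top a)) hm)
    · obtain ⟨K, hK, hVK⟩ := Sylow.exists_subgroup_card_pow_prime_le p
        (m := 3) (hm ▸ pow_dvd_pow p hlt) V hr (by omega)
      have hVK_index : V.relIndex K = p := by
        have := (V.subgroupOf K).card_mul_index
        rw [Nat.card_congr (Subgroup.subgroupOfEquivOfLe hVK).toEquiv, hK, hr, pow_succ p 2] at this
        exact Nat.eq_of_mul_eq_mul_left (pow_pos hp.pos 2) this
      have hexp_dvd : Monoid.exponent K ∣ p ^ 2 := by
        refine Monoid.exponent_dvd_of_forall_pow_eq_one fun a ↦ Subtype.ext ?_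
        have ha : a ^ p ∈ V.subgroupOf K := hVK_index ▸ (V.subgroupOf K).pow_index_mem a
        simpa [Subgroup.mem_subgroupOf, hmem, ← pow_mul, sq] using ha
      have hexp : Monoid.exponent K = p ^ (1 + 1) := by
        obtain ⟨k, hk, hk'⟩ := (Nat.dvd_prime_pow hp).1 hexp_dvd
        rcases hk.eq_or_lt with rfl | hk
        · exact hk'
        · have hKV : K ≤ V := fun a ha ↦ by
            have h1 := Monoid.exponent_dvd_iff_forall_pow_eq_one.1
              (hk' ▸ pow_dvd_pow p (by omega : k ≤ 1)) (⟨a, ha⟩ : K)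
            simpa [Subtype.ext_iff, hmem] using h1
          have := Subgroup.card_le_of_le hKV
          rw [hK, hr, Nat.pow_le_pow_iff_right hp.one_lt] at this
          omega
      have hphiK := phi_add_card_pow_eq_one hexp
      have hcard : Nat.card {a : K // a ^ p ^ 1 = 1} = p ^ 2 := by
        rw [← hr, ← Nat.card_congr (Subgroup.subgroupOfEquivOfLe hVK).toEquiv]
        refine Nat.card_congr (Equiv.subtypeEquivRight fun a ↦ ?_)
        simp [Subgroup.mem_subgroupOf, hmem, Subtype.ext_iff]
      rw [hcard, hK] at hphiK
      have hd := hdvd V K hVK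
      rw [hphi le_rfl hr, Nat.eq_sub_of_add_eq hphiK] at hd
      exact absurd hd (sq_sub_one_not_dvd_cube_sub_sq hp.two_le)
  · obtain ⟨K, hKV, hK⟩ := Sylow.exists_subgroup_le_card_pow_prime_of_le_card hp hG
      (hr ▸ Nat.pow_le_pow_right hp.pos h : p ^ 3 ≤ Nat.card V)
    obtain ⟨H, hHK, hH⟩ := Sylow.exists_subgroup_le_card_pow_prime_of_le_card hp hG
      (hK ▸ Nat.pow_le_pow_right hp.pos (by omega) : p ^ 2 ≤ Nat.card K)
    have hd := hdvd H K hHK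
    rw [hphi (hHK.trans hKV) hH, hphi hKV hK] at hd
    exact absurd hd (sq_sub_one_not_dvd_cube_sub_one hp.two_le)
end

section
/- Let p be a prime and let K be a finite group of order p³ containing a subgroup H isomorphic to ℤ_p × ℤ_p. Then φ(H) = p² − 1 does not divide φ(K). -/
theorem phi_of_forall_pow_eq_one (p : ℕ) [hp : Fact p.Prime] (G : Type*) [Group G] [Finite G]
    [Nontrivial G] (h : ∀ a : G, a ^ p = 1) :
    Monoid.exponent G = p ∧ phi G = Nat.card G - 1 := by
  have he : Monoid.exponent G = p := by
    rcases (Nat.dvd_prime hp.out).mp (Monoid.exponent_dvd_of_forall_pow_eq_one h) with h1 | h1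
    · have := Monoid.exp_eq_one_iff.mp h1
      exact absurd this (not_subsingleton G)
    · exact h1
  refine ⟨he, ?_⟩
  have hiff : ∀ a : G, orderOf a = Monoid.exponent G ↔ a ∈ ({1}ᶜ : Set G) := by
    intro a
    rw [he, Set.mem_compl_singleton_iff]
    refine ⟨?_, fun ha => orderOf_eq_prime (h a) ha⟩
    rintro ha rfl
    rw [orderOf_one] at ha
    exact hp.out.one_lt.ne ha
  have h1 := Set.ncard_add_ncard_compl ({1} : Set G)
  rw [Set.ncard_singleton] at h1
  rw [phi, Nat.card_congr (Equiv.subtypeEquivRight hiff), ← h1]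
  simp [Set.ncard]
  rfl

/-- The map `a ↦ a ^ (p + 1)` permutes the elements of order `p ^ 2` without fixed points, and its
`p`-th iterate is the identity. -/
theorem prime_dvd_card_orderOf_eq_sq (p : ℕ) [hp : Fact p.Prime] (G : Type*) [Group G] [Finite G] :
    p ∣ Nat.card {a : G // orderOf a = p ^ 2} := by
  classical
  have := Fintype.ofFinite G
  have hc : (p ^ 2).Coprime (p + 1) := by
    apply Nat.Coprime.pow_left
    simp
  let f : Function.End {a : G // orderOf a = p ^ 2} :=
    fun a => ⟨a.1 ^ (p + 1), by
      rw [Nat.Coprime.orderOf_pow (by rw [a.2]; exact hc), a.2]⟩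
  have hiter : ∀ (n : ℕ) (a : {a : G // orderOf a = p ^ 2}),
      ((f ^ n) a).1 = a.1 ^ ((p + 1) ^ n) := by
    intro n
    induction n with
    | zero => intro a; simp [Function.End.one_def]
    | succ n ih =>
      intro a
      have h1 : ((f ^ n) (f a)).1 = (a.1 ^ (p + 1)) ^ ((p + 1) ^ n) := ih (f a)
      rw [← pow_mul, ← pow_succ'] at h1
      exact h1
  have hf : f ^ p ^ 1 = 1 := by
    funext a
    apply Subtype.ext
    rw [hiter, pow_one]
    change _ = a.1
    conv_rhs => rw [← pow_one a.1]
    rw [pow_eq_pow_iff_modEq, a.2]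
    have hd : ((p : ℤ) ^ 2) ∣ ((p : ℤ) + 1) ^ p - 1 := by
      simpa using dvd_sub_pow_of_dvd_sub (R := ℤ) (a := (p : ℤ) + 1) (b := 1) (p := p) (by simp) 1
    apply Nat.ModEq.symm
    rw [Nat.modEq_iff_dvd]
    exact_mod_cast hd
  have hfix : IsEmpty (Function.fixedPoints f) := by
    refine ⟨fun ⟨a, ha⟩ => ?_⟩
    have h1 : a.1 ^ (p + 1) = a.1 := congrArg Subtype.val ha
    rw [pow_succ, mul_eq_right] at h1
    have h2 := orderOf_dvd_of_pow_eq_one h1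
    rw [a.2] at h2
    have := Nat.le_of_dvd hp.out.pos h2
    nlinarith [hp.out.two_le]
  have hmod := Equiv.Perm.card_fixedPoints_modEq hf
  rw [Nat.card_eq_fintype_card]
  rw [Fintype.card_eq_zero (α := Function.fixedPoints f)] at hmod
  exact (Nat.modEq_zero_iff_dvd).mp hmod

theorem orderOf_eq_sq_of_dvd (p : ℕ) [hp : Fact p.Prime] {G : Type*} [Group G] {a : G}
    (h2 : a ^ p ^ 2 = 1) (h1 : a ^ p ≠ 1) : orderOf a = p ^ 2 :=
  orderOf_eq_prime_pow (n := 1) (by simpa using h1) h2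

theorem stmt_6 (p : ℕ) [Fact p.Prime] (K : Type*) [Group K] [Finite K]
    (hK : Nat.card K = p ^ 3) (H : Subgroup K)
    (hH : Nonempty (H ≃* (Multiplicative (ZMod p) × Multiplicative (ZMod p)))) :
    phi H = p ^ 2 - 1 ∧ ¬ phi H ∣ phi K := by
  obtain ⟨e⟩ := hH
  have hp : p.Prime := Fact.out
  have h2 := hp.two_le
  have hcard : Nat.card H = p ^ 2 := by
    rw [Nat.card_congr e.toEquiv, Nat.card_prod, Nat.card_congr Multiplicative.toAdd, Nat.card_zmod,
      sq]
  have hpow : ∀ a : H, a ^ p = 1 := by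
    intro a
    apply e.injective
    rw [map_pow, map_one]
    ext
    · exact Multiplicative.toAdd.injective (by simp)
    · exact Multiplicative.toAdd.injective (by simp)
  have hntH : Nontrivial H := by
    rw [← Finite.one_lt_card_iff_nontrivial, hcard]
    nlinarith
  have hntK : Nontrivial K := by
    rw [← Finite.one_lt_card_iff_nontrivial, hK]
    nlinarith [sq_nonneg p]
  obtain ⟨heH, hphiH⟩ := phi_of_forall_pow_eq_one p H hpow
  rw [hcard] at hphiH
  refine ⟨hphiH, ?_⟩
  rw [hphiH]
  by_cases hall : ∀ a : K, a ^ p = 1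
  · rw [(phi_of_forall_pow_eq_one p K hall).2, hK]
    intro hd
    obtain ⟨q, rfl⟩ : ∃ q, p = q + 2 := ⟨p - 2, by omega⟩
    have e1 : (q + 2) ^ 2 - 1 = q ^ 2 + 4 * q + 3 := by
      apply Nat.sub_eq_of_eq_add; ring
    have h3 : (q + 2) ^ 3 - 1 = ((q + 2) ^ 2 - 1) * (q + 2) + (q + 1) := by
      rw [e1]
      apply Nat.sub_eq_of_eq_add; ring
    rw [h3, Nat.dvd_add_right (dvd_mul_right _ _)] at hd
    have h4 := Nat.le_of_dvd (by omega) hd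
    rw [e1] at h4
    nlinarith
  · push Not at hall
    obtain ⟨b, hb⟩ := hall
    have hsq : ∀ a : K, a ^ p ^ 2 = 1 := by
      intro a
      by_contra hne
      have ho : orderOf a = p ^ 3 :=
        orderOf_eq_prime_pow (n := 2) hne (by rw [← hK]; exact pow_card_eq_one')
      have hcyc : IsCyclic K := isCyclic_of_orderOf_eq_card a (by rw [ho, hK])
      have h5 := IsCyclic.exponent_eq_card (α := H)
      rw [heH, hcard] at h5
      nlinarith
    have hbo := orderOf_eq_sq_of_dvd p (hsq b) hb
    have heK : Monoid.exponent K = p ^ 2 :=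
      Nat.dvd_antisymm (Monoid.exponent_dvd_of_forall_pow_eq_one hsq)
        (hbo ▸ Monoid.order_dvd_exponent b)
    have hphiK : phi K = Nat.card {a : K // orderOf a = p ^ 2} := by rw [phi, heK]
    have hpd : p ∣ phi K := hphiK ▸ prime_dvd_card_orderOf_eq_sq p K
    have hpos : 0 < phi K := by
      rw [hphiK]
      have : Nonempty {a : K // orderOf a = p ^ 2} := ⟨⟨b, hbo⟩⟩
      exact Nat.card_pos
    have hle : phi K + p ^ 2 ≤ p ^ 3 := by
      have hs : {a : K | orderOf a = p ^ 2} ⊆ (H : Set K)ᶜ := by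
        intro a ha haH
        have h6 : a ^ p = 1 := congrArg Subtype.val (hpow ⟨a, haH⟩)
        have h7 := orderOf_dvd_of_pow_eq_one h6
        have ho : orderOf a = p ^ 2 := ha
        rw [ho] at h7
        have := Nat.le_of_dvd hp.pos h7
        nlinarith
      have h8 := Set.ncard_le_ncard hs
      have h9 := Set.ncard_add_ncard_compl (H : Set K)
      have h10 : (H : Set K).ncard = p ^ 2 := hcard
      have h11 : phi K = {a : K | orderOf a = p ^ 2}.ncard := hphiK
      omega
    intro hd
    have hcop : Nat.Coprime p (p ^ 2 - 1) := by
      rw [hp.coprime_iff_not_dvd]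
      intro h
      have h12 := (Nat.dvd_sub_iff_right (by nlinarith) (dvd_pow_self p two_ne_zero)).mp h
      exact hp.one_lt.ne' (Nat.dvd_one.mp h12)
    have h13 := Nat.le_of_dvd hpos (hcop.mul_dvd_of_dvd_of_dvd hpd hd)
    have h14 : p ^ 2 - 1 + 1 = p ^ 2 := Nat.sub_add_cancel (by nlinarith)
    have h15 : p * (p ^ 2 - 1) + p = p ^ 3 := by
      calc p * (p ^ 2 - 1) + p = p * (p ^ 2 - 1 + 1) := by ring
        _ = p ^ 3 := by rw [h14]; ring
    nlinarith
end

section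
/- Let p be a prime and let G be a finite non-abelian p-group all of whose abelian subgroups are cyclic, and suppose that for all subgroups H, K of G with H ⊆ K, φ(H) divides φ(K). Then G is isomorphic to the quaternion group Q₈. -/
theorem mem_zpowers_of_pow_prime_eq_one {H : Type*} [Group H] [Finite H] [IsCyclic H] {p : ℕ}
    (hp : 0 < p) {y z : H} (hz : orderOf z = p) (hy : y ^ p = 1) :
    y ∈ Subgroup.zpowers z := by
  classical
  have := Fintype.ofFinite H
  have hle := IsCyclic.card_pow_eq_one_le (α := H) hp
  have hsub : (Finset.univ.filter fun a : H => a ∈ Subgroup.zpowers z) ⊆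
      Finset.univ.filter fun a : H => a ^ p = 1 := by
    intro a ha
    simp only [Finset.mem_filter, Finset.mem_univ, true_and] at ha ⊢
    exact orderOf_dvd_iff_pow_eq_one.1 (hz ▸ orderOf_dvd_of_mem_zpowers ha)
  have hcard : (Finset.univ.filter fun a : H => a ∈ Subgroup.zpowers z).card = p := by
    rw [← hz, ← Nat.card_zpowers, ← Fintype.card_subtype, Nat.card_eq_fintype_card]
  have heq := Finset.eq_of_subset_of_card_le hsub (by rw [hcard]; exact hle)
  have : y ∈ Finset.univ.filter fun a : H => a ^ p = 1 := by simp [hy]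
  rw [← heq] at this
  simpa using this

theorem exists_isCyclic_subgroup_of_commute {G : Type*} [Group G]
    (hab : ∀ H : Subgroup G, (∀ a b : H, a * b = b * a) → IsCyclic H) {x y : G}
    (h : Commute x y) : ∃ H : Subgroup G, IsCyclic H ∧ x ∈ H ∧ y ∈ H := by
  refine ⟨Subgroup.closure {x, y}, hab _ ?_, Subgroup.subset_closure (by simp),
    Subgroup.subset_closure (by simp)⟩
  have := Subgroup.isMulCommutative_closure (k := {x, y}) (by
    rintro a (rfl | rfl) b (rfl | rfl)
    · rfl
    · exact h
    · exact h.symm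
    · rfl)
  exact fun a b => mul_comm' a b

theorem exists_mem_zpowers_of_commute {G : Type*} [Group G]
    (hab : ∀ H : Subgroup G, (∀ a b : H, a * b = b * a) → IsCyclic H) {x y : G}
    (h : Commute x y) : ∃ g : G, x ∈ Subgroup.zpowers g ∧ y ∈ Subgroup.zpowers g := by
  obtain ⟨H, hH, hx, hy⟩ := exists_isCyclic_subgroup_of_commute hab h
  obtain ⟨g, hg⟩ := hH.exists_generator
  refine ⟨g, ?_, ?_⟩
  · obtain ⟨n, hn⟩ := hg ⟨x, hx⟩
    exact ⟨n, by simpa using congrArg Subtype.val hn⟩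
  · obtain ⟨n, hn⟩ := hg ⟨y, hy⟩
    exact ⟨n, by simpa using congrArg Subtype.val hn⟩

theorem mem_zpowers_of_mem_center {G : Type*} [Group G] [Finite G]
    (hab : ∀ H : Subgroup G, (∀ a b : H, a * b = b * a) → IsCyclic H) {p : ℕ} (hp : 0 < p)
    {y z : G} (hzc : z ∈ Subgroup.center G) (hz : orderOf z = p) (hy : y ^ p = 1) :
    y ∈ Subgroup.zpowers z := by
  obtain ⟨H, hH, hyH, hzH⟩ := exists_isCyclic_subgroup_of_commute hab
    (show Commute y z from Subgroup.mem_center_iff.1 hzc y)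
  obtain ⟨n, hn⟩ := mem_zpowers_of_pow_prime_eq_one (H := H) hp (y := ⟨y, hyH⟩) (z := ⟨z, hzH⟩)
    (by rw [← Subgroup.orderOf_coe]; exact hz) (Subtype.ext hy)
  exact ⟨n, by simpa using congrArg Subtype.val hn⟩

theorem mul_pow_eq_of_mul_eq {G : Type*} [Group G] {x b v : G} (hv : v ∈ Subgroup.center G)
    (h : b * x = v * x * b) (n : ℕ) : (x * b) ^ n = v ^ n.choose 2 * x ^ n * b ^ n := by
  have hvc (g : G) : Commute v g := (Subgroup.mem_center_iff.1 hv g).symm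
  have hb : ∀ n : ℕ, b ^ n * x = v ^ n * x * b ^ n := by
    intro n
    induction n with
    | zero => simp
    | succ n ih =>
      rw [pow_succ', mul_assoc, ih, ← mul_assoc, ← mul_assoc, ← ((hvc b).pow_left n).eq,
        mul_assoc (v ^ n), h, pow_succ]
      simp only [mul_assoc]
  induction n with
  | zero => simp
  | succ n ih =>
    have e : n.succ.choose 2 = n.choose 2 + n := by
      rw [Nat.choose_succ_succ' n 1, Nat.choose_one_right, add_comm]
    rw [pow_succ, ih, e]
    calc v ^ n.choose 2 * x ^ n * b ^ n * (x * b)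
        = v ^ n.choose 2 * x ^ n * (b ^ n * x) * b := by simp only [mul_assoc]
      _ = v ^ n.choose 2 * (x ^ n * v ^ n) * x * b ^ n * b := by rw [hb]; simp only [mul_assoc]
      _ = _ := by
        rw [← ((hvc (x ^ n)).pow_left n).eq, pow_add, pow_succ, pow_succ]
        simp only [mul_assoc]

theorem pow_mul_eq_of_mul_eq {G : Type*} [Group G] {x b v : G} (hv : v ∈ Subgroup.center G)
    (h : b * x = v * x * b) (n : ℕ) : b * x ^ n = v ^ n * x ^ n * b := by
  have hvc (g : G) : Commute v g := (Subgroup.mem_center_iff.1 hv g).symm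
  induction n with
  | zero => simp
  | succ n ih =>
    rw [pow_succ x, ← mul_assoc, ih, mul_assoc, h, pow_succ v]
    simp only [mul_assoc]
    rw [← mul_assoc (x ^ n) v, ← (hvc (x ^ n)).eq]
    simp only [mul_assoc]

theorem exists_mem_upperCentralSeries_two {p : ℕ} [Fact p.Prime] {G : Type*} [Group G] [Finite G]
    (hG : IsPGroup p G) (hnab : ¬ ∀ a b : G, a * b = b * a) :
    ∃ x : G, x ∉ Subgroup.center G ∧ x ^ p ∈ Subgroup.center G ∧
      ∀ g : G, ∃ v ∈ Subgroup.center G, g * x = v * x * g := by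
  have hnt : Nontrivial (G ⧸ Subgroup.center G) := by
    rw [QuotientGroup.nontrivial_iff]
    intro h
    exact hnab fun a b => Subgroup.mem_center_iff.1 (h ▸ Subgroup.mem_top b : b ∈ Subgroup.center G) a
  have hQ := hG.to_quotient (Subgroup.center G)
  have hc := hQ.center_nontrivial
  have hcp := hQ.to_subgroup (Subgroup.center (G ⧸ Subgroup.center G))
  obtain ⟨n, hn, hcard⟩ := hcp.nontrivial_iff_card.1 hc
  obtain ⟨⟨q, hqc⟩, hq⟩ := exists_prime_orderOf_dvd_card' p
    (G := Subgroup.center (G ⧸ Subgroup.center G)) (hcard ▸ dvd_pow_self p hn.ne')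
  obtain ⟨x, rfl⟩ := QuotientGroup.mk_surjective q
  rw [← Subgroup.orderOf_coe] at hq
  simp only at hq
  refine ⟨x, fun hx => ?_, ?_, fun g => ?_⟩
  · rw [(QuotientGroup.eq_one_iff x).2 hx, orderOf_one] at hq
    exact (Fact.out : p.Prime).one_lt.ne hq
  · rw [← QuotientGroup.eq_one_iff, QuotientGroup.mk_pow, ← hq, pow_orderOf_eq_one]
  · refine ⟨g * x * g⁻¹ * x⁻¹, ?_, by group⟩
    have := Subgroup.mem_center_iff.1 hqc (g : G ⧸ Subgroup.center G)
    rw [← QuotientGroup.eq_one_iff, QuotientGroup.mk_mul, QuotientGroup.mk_mul,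
      QuotientGroup.mk_mul, this]
    simp

/-- A nonabelian `p`-group all of whose abelian subgroups are cyclic has `p = 2`, has a unique
involution, and contains a standard pair of generators of a quaternion group. -/
theorem exists_quaternion_generators {p : ℕ} [Fact p.Prime] {G : Type*} [Group G] [Finite G]
    (hG : IsPGroup p G) (hnab : ¬ ∀ a b : G, a * b = b * a)
    (hab : ∀ H : Subgroup G, (∀ a b : H, a * b = b * a) → IsCyclic H) :
    p = 2 ∧ ∃ z h c : G, z ≠ 1 ∧ z ^ 2 = 1 ∧ (∀ y : G, y ^ 2 = 1 → y = 1 ∨ y = z) ∧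
      h ^ 2 = z ∧ c ^ 2 = z ∧ h * c = z * c * h := by
  have hp : p.Prime := Fact.out
  obtain ⟨x, hxc, hxp, hx⟩ := exists_mem_upperCentralSeries_two hG hnab
  have hGnt : Nontrivial G := by
    by_contra h
    rw [not_nontrivial_iff_subsingleton] at h
    exact hnab fun a b => Subsingleton.elim _ _
  have hc := hG.center_nontrivial
  obtain ⟨n, hn, hcard⟩ := (hG.to_subgroup (Subgroup.center G)).nontrivial_iff_card.1 hc
  obtain ⟨⟨z, hzc⟩, hz⟩ := exists_prime_orderOf_dvd_card' p
    (G := Subgroup.center G) (hcard ▸ dvd_pow_self p hn.ne')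
  rw [← Subgroup.orderOf_coe] at hz
  simp only at hz
  have hU : ∀ y : G, y ^ p = 1 → y ∈ Subgroup.zpowers z := fun y hy =>
    mem_zpowers_of_mem_center hab hp.pos hzc hz hy
  have hUc : ∀ y : G, y ^ p = 1 → y ∈ Subgroup.center G := fun y hy =>
    (Subgroup.zpowers_le.2 hzc) (hU y hy)
  obtain ⟨g, hg⟩ : ∃ g, ¬ Commute g x := by
    by_contra! h
    exact hxc (Subgroup.mem_center_iff.2 h)
  obtain ⟨h, hxh, hgh⟩ := exists_mem_zpowers_of_commute hab
    (show Commute (x ^ p) g from (Subgroup.mem_center_iff.1 hxp g).symm)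
  have hhx : ¬ Commute h x := by
    obtain ⟨k, rfl⟩ := hgh
    exact fun H => hg (H.zpow_left k)
  obtain ⟨m, hm⟩ := mem_powers_iff_mem_zpowers.2 hxh
  simp only at hm
  obtain ⟨N, hN⟩ := IsPGroup.iff_orderOf.1 hG h
  have hpm : p ∣ m := by
    by_contra hpm
    obtain ⟨k, hk⟩ := exists_pow_eq_self_of_coprime (n := m) (x := h) (by
      rw [hN]; exact (((Nat.Prime.coprime_iff_not_dvd hp).2 hpm).pow_left N).symm)
    apply hhx
    rw [← hk, hm, ← pow_mul]
    exact (Commute.refl x).pow_left _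
  obtain ⟨m, rfl⟩ := hpm
  obtain ⟨v, hvc, hv⟩ := hx ((h ^ m)⁻¹)
  have hvp : v ^ p = 1 := by
    have h1 := pow_mul_eq_of_mul_eq hvc hv p
    rw [Subgroup.mem_center_iff.1 hxp, mul_assoc] at h1
    exact (mul_eq_right.1 h1.symm)
  have hcp := mul_pow_eq_of_mul_eq hvc hv p
  rw [← hm, mul_assoc, inv_pow, ← pow_mul, mul_comm m p, mul_inv_cancel, mul_one] at hcp
  set c := x * (h ^ m)⁻¹ with hcdef
  have hhc : ¬ Commute h c := by
    intro H
    apply hhx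
    have : x = c * h ^ m := by simp [hcdef]
    rw [this]
    exact H.mul_right ((Commute.refl h).pow_right m)
  have hcnc : c ∉ Subgroup.center G := fun H => hhc (Subgroup.mem_center_iff.1 H h)
  have hp2 : p = 2 := by
    by_contra hne
    have hdvd : p ∣ p.choose 2 := hp.dvd_choose_self two_ne_zero
      (lt_of_le_of_ne hp.two_le (Ne.symm hne))
    obtain ⟨k, hk⟩ := hdvd
    rw [hk, pow_mul, hvp, one_pow] at hcp
    exact hcnc (hUc c hcp)
  subst hp2
  have hz1 : z ≠ 1 := by rintro rfl; simp at hz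
  have hz2 : z ^ 2 = 1 := hz ▸ pow_orderOf_eq_one z
  have hinv : ∀ y : G, y ^ 2 = 1 → y = 1 ∨ y = z := by
    intro y hy
    obtain ⟨k, rfl⟩ := mem_powers_iff_mem_zpowers.2 (hU y hy)
    simp only
    rcases Nat.even_or_odd' k with ⟨j, rfl | rfl⟩
    · left; rw [pow_mul, hz2, one_pow]
    · right; rw [pow_succ, pow_mul, hz2, one_pow, one_mul]
  have hcc : c ^ 2 = z := by
    refine (hinv (c ^ 2) ?_).resolve_left fun H => hcnc (hUc c H)
    rw [hcp, Nat.choose_self, pow_one, hvp]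
  obtain ⟨w, hwc, hw⟩ := hx h
  have hwz : w = z := by
    refine (hinv w ?_).resolve_left ?_
    · have h1 := pow_mul_eq_of_mul_eq hwc hw 2
      rw [Subgroup.mem_center_iff.1 hxp, mul_assoc] at h1
      exact (mul_eq_right.1 h1.symm)
    · rintro rfl
      exact hhx (by simpa [Commute, SemiconjBy] using hw)
  subst hwz
  have hcomm : h * c = w * c * h := by
    rw [hcdef, ← mul_assoc, hw]
    have : Commute h ((h ^ m)⁻¹) := ((Commute.refl h).pow_right m).inv_right
    simp only [mul_assoc, this.eq]
  refine ⟨rfl, w, h, c, hz1, hz2, hinv, ?_, hcc, hcomm⟩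
  have hwC (g : G) : Commute w g := (Subgroup.mem_center_iff.1 hwc g).symm
  have hh2c : Commute (h ^ 2) c := by
    have : h ^ 2 * c = c * h ^ 2 := by
      calc h ^ 2 * c = h * (h * c) := by rw [sq, mul_assoc]
        _ = (h * w) * c * h := by rw [hcomm]; simp only [mul_assoc]
        _ = w * (h * c) * h := by rw [← (hwC h).eq]; simp only [mul_assoc]
        _ = w ^ 2 * c * h ^ 2 := by rw [hcomm, sq, sq]; simp only [mul_assoc]
        _ = c * h ^ 2 := by rw [hz2, one_mul]
    exact this
  have hh2 : h ^ 2 ≠ 1 := fun H => hhc ((Subgroup.mem_center_iff.1 (hUc h H) c).symm)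
  have hh4 : h ^ 4 = 1 := by
    by_contra h4
    have hN3 : 3 ≤ N := by
      by_contra! hlt
      apply h4
      have : orderOf h ∣ 4 := by
        rw [hN]
        exact pow_dvd_pow 2 (show N ≤ 2 by omega)
      exact orderOf_dvd_iff_pow_eq_one.1 this
    obtain ⟨j, rfl⟩ := Nat.exists_eq_add_of_le hN3
    have hu2 : (h ^ 2 ^ (j + 1)) ^ 2 = w := by
      refine (hinv _ ?_).resolve_left ?_
      · rw [← pow_mul, ← pow_mul, ← orderOf_dvd_iff_pow_eq_one, hN]
        exact dvd_of_eq (by ring)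
      · rw [← pow_mul, ← orderOf_dvd_iff_pow_eq_one, hN, ← pow_succ, Nat.pow_dvd_pow_iff_le_right (by norm_num)]
        omega
    have huc : Commute (h ^ 2 ^ (j + 1)) c := by
      rw [pow_succ', pow_mul]
      exact hh2c.pow_left _
    have hcu : (c * h ^ 2 ^ (j + 1)) ^ 2 = 1 := by
      rw [huc.symm.mul_pow, hcc, hu2, ← sq, hz2]
    have hcuc : Commute h (c * h ^ 2 ^ (j + 1)) := Subgroup.mem_center_iff.1 (hUc _ hcu) h
    apply hhc
    have := hcuc.mul_right ((Commute.refl h).pow_right (2 ^ (j + 1))).inv_right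
    simpa using this
  exact (hinv _ (by rw [← pow_mul]; exact hh4)).resolve_left hh2

theorem exists_quaternionGroup_two_hom {G : Type*} [Group G] {z h c : G} (hz1 : z ≠ 1)
    (hz2 : z ^ 2 = 1) (hh : h ^ 2 = z) (hc : c ^ 2 = z) (hhc : h * c = z * c * h) :
    ∃ f : QuaternionGroup 2 →* G, Function.Injective f := by
  have h4 : h ^ 4 = 1 := by rw [show 4 = 2 * 2 from rfl, pow_mul, hh, hz2]
  have hord : orderOf h = 4 :=
    orderOf_eq_prime_pow (p := 2) (n := 1) (by simpa [hh] using hz1) h4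
  let e : ZMod (2 * 2) → G := fun i => h ^ i.val
  have hadd : ∀ i j, e (i + j) = e i * e j := by
    intro i j
    simp only [e]
    rw [ZMod.val_add, ← pow_add]
    exact pow_inj_mod.2 (by rw [hord]; exact Nat.mod_mod _ _)
  have h1 : h * c = c * h ^ 3 := by
    rw [hhc, ← hc, pow_succ h 2, hh, ← hc]
    group
  have hpow : ∀ n : ℕ, h ^ n * c = c * (h ^ 3) ^ n := by
    intro n
    induction n with
    | zero => simp
    | succ n ih => rw [pow_succ, mul_assoc, h1, ← mul_assoc, ih, mul_assoc, ← pow_succ]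
  have hneg : ∀ i, e i * c = c * e (-i) := by
    intro i
    simp only [e]
    rw [hpow, ← pow_mul]
    congr 1
    apply pow_inj_mod.2
    rw [hord]
    revert i
    decide
  have h2 : e 2 = c * c := by
    exact hh.trans (hc.symm.trans (sq c))
  have h0 : e 0 = 1 := pow_zero h
  let F : QuaternionGroup 2 → G
    | .a i => e i
    | .xa i => c * e i
  have hF : ∀ x y, F (x * y) = F x * F y := by
    rintro (i | i) (j | j)
    · exact hadd i j
    · change c * e (j - i) = e i * (c * e j)
      rw [← mul_assoc, hneg, mul_assoc, ← hadd, neg_add_eq_sub]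
    · change c * e (i + j) = c * e i * e j
      rw [hadd, mul_assoc]
    · change e (2 + j - i) = c * e i * (c * e j)
      rw [mul_assoc, ← mul_assoc (e i), hneg, mul_assoc, ← hadd, ← mul_assoc, ← h2, ← hadd]
      congr 1
      ring
  refine ⟨MonoidHom.mk' F hF, (injective_iff_map_eq_one _).2 ?_⟩
  have he : ∀ i, e i = 1 → i = 0 := by
    intro i hi
    have := orderOf_dvd_of_pow_eq_one (show h ^ i.val = 1 from hi)
    rw [hord] at this
    exact (ZMod.val_eq_zero i).1 (Nat.eq_zero_of_dvd_of_lt this (ZMod.val_lt i))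
  rintro (i | i) hi
  · rw [he i hi, QuaternionGroup.a_zero]
  · exfalso
    have hi : c * e i = 1 := hi
    have hcomm : h * c = c * h := by
      rw [eq_inv_of_mul_eq_one_left hi]
      exact ((Commute.refl h).pow_right _).inv_right
    rw [hhc, mul_assoc] at hcomm
    exact hz1 (mul_eq_right.1 hcomm)

theorem phi_eq_card_sub_two {K : Type*} [Group K] [Finite K] {z : K} (hz1 : z ≠ 1)
    (hz2 : z ^ 2 = 1) (hinv : ∀ y : K, y ^ 2 = 1 → y = 1 ∨ y = z) (h4 : ∀ y : K, y ^ 4 = 1)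
    (hne : ∃ x : K, x ^ 2 ≠ 1) : phi K = Nat.card K - 2 := by
  classical
  have := Fintype.ofFinite K
  have key : ∀ x : K, orderOf x = 4 ↔ x ∉ ({1, z} : Finset K) := by
    intro x
    constructor
    · intro hx hmem
      have : x ^ 2 = 1 := by
        rcases (by simpa using hmem : x = 1 ∨ x = z) with rfl | rfl
        · simp
        · exact hz2
      have := orderOf_dvd_of_pow_eq_one this
      rw [hx] at this
      norm_num at this
    · intro hx
      have : x ^ 2 ^ 1 ≠ 1 := fun H => hx (by simpa using hinv x H)
      exact orderOf_eq_prime_pow (p := 2) (n := 1) this (h4 x)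
  have hexp : Monoid.exponent K = 4 := by
    apply Nat.dvd_antisymm (Monoid.exponent_dvd_of_forall_pow_eq_one h4)
    obtain ⟨x, hx⟩ := hne
    have : orderOf x = 4 := orderOf_eq_prime_pow (p := 2) (n := 1) hx (h4 x)
    exact this ▸ Monoid.order_dvd_exponent x
  rw [phi, hexp, Nat.card_eq_fintype_card, Nat.card_eq_fintype_card]
  simp_rw [key]
  rw [Fintype.card_subtype, Finset.filter_notMem_eq_sdiff, ← Finset.compl_eq_univ_sdiff,
    Finset.card_compl, Finset.card_pair hz1.symm]

theorem phi_eq_totient_of_isCyclic (H : Type*) [Group H] [Finite H] [IsCyclic H] :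
    phi H = (Nat.card H).totient := by
  classical
  have := Fintype.ofFinite H
  rw [phi, IsCyclic.exponent_eq_card, Nat.card_eq_fintype_card, Fintype.card_subtype,
    Nat.card_eq_fintype_card]
  exact IsCyclic.card_orderOf_eq_totient dvd_rfl

theorem phi_add_card_le {K : Type*} [Group K] [Finite K] (Q : Subgroup K)
    (hQ : ∀ q ∈ Q, orderOf q ≠ Monoid.exponent K) : phi K + Nat.card Q ≤ Nat.card K := by
  have h1 : phi K = {a : K | orderOf a = Monoid.exponent K}.ncard := rfl
  have h2 : Nat.card Q = (Q : Set K).ncard := rfl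
  rw [h1, h2, ← Set.ncard_union_eq, ← Set.ncard_univ]
  · exact Set.ncard_le_ncard (Set.subset_univ _)
  · exact Set.disjoint_left.2 fun a ha hq => hQ a hq ha

theorem stmt_7 (p : ℕ) [Fact p.Prime] (G : Type*) [Group G] [Finite G]
    (hG : IsPGroup p G)
    (hnab : ¬ ∀ a b : G, a * b = b * a)
    (hab : ∀ H : Subgroup G, (∀ a b : H, a * b = b * a) → IsCyclic H)
    (hdvd : ∀ H K : Subgroup G, H ≤ K → phi H ∣ phi K) :
    Nonempty (G ≃* QuaternionGroup 2) := by
  obtain ⟨rfl, z, h, c, hz1, hz2, hinv, hh, hc, hhc⟩ := exists_quaternion_generators hG hnab hab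
  obtain ⟨f, hf⟩ := exists_quaternionGroup_two_hom hz1 hz2 hh hc hhc
  let eQ : QuaternionGroup 2 ≃* f.range := MonoidHom.ofInjective hf
  have hQcard : Nat.card f.range = 8 := by
    rw [← Nat.card_congr eQ.toEquiv, Nat.card_eq_fintype_card, QuaternionGroup.card]
  have hQ4 : ∀ y : f.range, y ^ 4 = 1 := by
    have : ∀ q : QuaternionGroup 2, q ^ 4 = 1 := by decide
    intro y
    obtain ⟨q, rfl⟩ := eQ.surjective y
    rw [← map_pow, this, map_one]
  have hphi : ∀ K : Subgroup G, f.range ≤ K → (∀ y : K, y ^ 4 = 1) → phi K = Nat.card K - 2 := by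
    intro K hK hK4
    have hx : (QuaternionGroup.a 1 : QuaternionGroup 2) ^ 2 ≠ 1 := by decide
    let x : K := ⟨f (QuaternionGroup.a 1), hK ⟨_, rfl⟩⟩
    have hx2 : x ^ 2 ≠ 1 := fun H => hx (hf (by
      rw [map_pow, map_one]
      exact congrArg Subtype.val H))
    have hxz : ((x ^ 2 : K) : G) = z := by
      refine (hinv _ ?_).resolve_left fun H => hx2 (Subtype.ext H)
      rw [← Subgroup.coe_pow, ← pow_mul, hK4, Subgroup.coe_one]
    refine phi_eq_card_sub_two hx2 (by rw [← pow_mul, hK4]) (fun y hy => ?_) hK4 ⟨x, hx2⟩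
    refine (hinv y (by rw [← Subgroup.coe_pow, hy, Subgroup.coe_one])).imp
      (fun H => Subtype.ext H) fun H => Subtype.ext (H.trans hxz.symm)
  have hQphi : phi f.range = 6 := by rw [hphi _ le_rfl hQ4, hQcard]
  obtain ⟨N, hN⟩ := IsPGroup.iff_card.1 hG
  have hle : 3 ≤ N := by
    have h1 := Subgroup.card_subgroup_dvd_card f.range
    rw [hQcard, hN, show 8 = 2 ^ 3 from rfl, Nat.pow_dvd_pow_iff_le_right (by norm_num)] at h1
    exact h1
  rcases hle.eq_or_lt with rfl | hlt
  · have htop : f.range = ⊤ := Subgroup.eq_top_of_card_eq _ (by rw [hQcard, hN]; rfl)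
    exact ⟨(MulEquiv.ofBijective f ⟨hf, MonoidHom.range_eq_top.1 htop⟩).symm⟩
  exfalso
  obtain ⟨K, hKcard, hK⟩ := Sylow.exists_subgroup_card_pow_succ (p := 2) (n := 3)
    (hN ▸ pow_dvd_pow 2 hlt) hQcard
  have hd := hdvd _ _ hK
  rw [hQphi] at hd
  by_cases hK4 : ∀ y : K, y ^ 4 = 1
  · rw [hphi K hK hK4, hKcard] at hd
    norm_num at hd
  push Not at hK4
  obtain ⟨x, hx⟩ := hK4
  have hKnc : ¬ IsCyclic K := by
    intro hcyc
    have hcomm : ∀ u v : QuaternionGroup 2, u * v = v * u := by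
      intro u v
      apply hf
      have := IsCyclic.isMulCommutative (α := K)
      have := mul_comm' (M := K) ⟨f u, hK ⟨u, rfl⟩⟩ ⟨f v, hK ⟨v, rfl⟩⟩
      simpa using congrArg Subtype.val this
    exact absurd hcomm (by decide)
  have hK8 : ∀ y : K, y ^ 8 = 1 := by
    intro y
    obtain ⟨k, hk, hky⟩ := (Nat.dvd_prime_pow Nat.prime_two).1 (hKcard ▸ orderOf_dvd_natCard y)
    have : k ≠ 4 := by
      rintro rfl
      exact hKnc (isCyclic_of_orderOf_eq_card y (hky.trans hKcard.symm))
    rw [← orderOf_dvd_iff_pow_eq_one, hky]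
    exact pow_dvd_pow 2 (show k ≤ 3 by omega)
  have hx8 : orderOf x = 8 := orderOf_eq_prime_pow (p := 2) (n := 2) hx (hK8 x)
  have hexp : Monoid.exponent K = 8 :=
    Nat.dvd_antisymm (Monoid.exponent_dvd_of_forall_pow_eq_one hK8)
      (hx8 ▸ Monoid.order_dvd_exponent x)
  have hpos : 0 < phi K := by
    have : Nonempty {a : K // orderOf a = Monoid.exponent K} := ⟨x, hx8.trans hexp.symm⟩
    exact Nat.card_pos
  have h4 := hdvd (Subgroup.zpowers (x : G)) K (Subgroup.zpowers_le.2 x.2)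
  rw [phi_eq_totient_of_isCyclic, Nat.card_zpowers, Subgroup.orderOf_coe, hx8,
    show Nat.totient 8 = 4 by decide] at h4
  have hbound := phi_add_card_le (f.range.subgroupOf K) (by
    intro q hq H
    have : q ^ 4 = 1 := Subtype.ext (by
      simpa using congrArg Subtype.val (hQ4 ⟨q, Subgroup.mem_subgroupOf.1 hq⟩))
    have := orderOf_dvd_of_pow_eq_one this
    rw [H, hexp] at this
    norm_num at this)
  rw [Nat.card_congr (Subgroup.subgroupOfEquivOfLe hK).toEquiv, hQcard, hKcard] at hbound
  omega
end

section
/- For every integer n ≥ 4, the generalized quaternion group G = Q_{2^n} does not satisfy the divisibility condition: there exist subgroups H ⊆ K of G such that φ(H) does not divide φ(K). In fact, G contains a subgroup H isomorphic to Q₈ with φ(H) = 6, and 6 does not divide φ(G) = 2^{n−2}. -/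
namespace QuaternionGroup

/-- Sending `a i` to `a (m * i)` and `xa i` to `xa (m * i)` embeds one dicyclic group in another. -/
theorem exists_injective_monoidHom_mul (m n : ℕ) [NeZero m] :
    ∃ f : QuaternionGroup n →* QuaternionGroup (m * n), Function.Injective f := by
  let g : {f : ℤ →+ ZMod (2 * (m * n)) // f (2 * n : ℕ) = 0} :=
    ⟨zmultiplesHom _ (m : ZMod (2 * (m * n))), by
      have h : ((2 * (m * n) : ℕ) : ZMod (2 * (m * n))) = 0 := ZMod.natCast_self _
      push_cast at h
      simp only [zmultiplesHom_apply, zsmul_eq_mul]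
      push_cast
      linear_combination h⟩
  let h := ZMod.lift (2 * n) g
  have h_inj : Function.Injective h := by
    refine (ZMod.lift_injective _).2 fun k hk => ?_
    have hk' : ((k * m : ℤ) : ZMod (2 * (m * n))) = 0 := by
      simpa [g] using hk
    rw [ZMod.intCast_zmod_eq_zero_iff_dvd] at hk'
    rw [ZMod.intCast_zmod_eq_zero_iff_dvd]
    refine Int.dvd_of_mul_dvd_mul_right (Int.natCast_ne_zero.2 (NeZero.ne m)) ?_
    convert hk' using 1
    push_cast
    ring
  have h_n : h (n : ZMod (2 * n)) = ((m * n : ℕ) : ZMod (2 * (m * n))) := by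
    have := ZMod.lift_coe (2 * n) g n
    rw [Int.cast_natCast] at this
    simp only [h, this, g, zmultiplesHom_apply, zsmul_eq_mul]
    push_cast
    ring
  refine ⟨MonoidHom.mk' (fun
    | a i => a (h i)
    | xa i => xa (h i)) ?_, ?_⟩
  · rintro (i | i) (j | j) <;> simp [h_n]
  · rintro (i | i) (j | j) hij <;> simp_all [h_inj.eq_iff]

theorem phi_two : phi (QuaternionGroup 2) = 6 := by
  have h4 : ∀ x : QuaternionGroup 2, x ^ 4 = 1 := by decide
  have h : ∀ x : QuaternionGroup 2, orderOf x = 4 ↔ x ^ 2 ≠ 1 := fun x => by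
    refine ⟨fun hx h2 => ?_, fun h2 => ?_⟩
    · have := orderOf_dvd_of_pow_eq_one h2
      rw [hx] at this
      omega
    · exact orderOf_eq_prime_pow (p := 2) (n := 1) (by simpa using h2) (h4 x)
  have he : Monoid.exponent (QuaternionGroup 2) = 4 := by
    rw [exponent]
    rfl
  simp only [phi, he, h]
  rw [Nat.card_eq_fintype_card]
  decide

/-- An even dicyclic group of order `4 * n > 8` has exactly `φ (2 * n)` elements of maximal
order. -/
theorem phi_eq_totient {n : ℕ} (hn : 2 < n) (h2 : 2 ∣ n) :
    phi (QuaternionGroup n) = (2 * n).totient := by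
  have : NeZero n := ⟨by omega⟩
  have he : Monoid.exponent (QuaternionGroup n) = 2 * n := by
    rw [exponent]
    exact congrArg (2 * ·) (Nat.lcm_eq_left h2)
  have ha (i : ZMod (2 * n)) :
      orderOf (a i) = Monoid.exponent (QuaternionGroup n) ↔ i.val.Coprime (2 * n) := by
    rw [he, orderOf_a, Nat.div_eq_self, Nat.coprime_comm, Nat.coprime_iff_gcd_eq_one]
    omega
  rw [← ZMod.card_units_eq_totient, ← Nat.card_eq_fintype_card,
    Nat.card_congr ZMod.unitsEquivCoprime]
  refine (Nat.card_congr (Equiv.ofBijective (fun i => ⟨a i.1, (ha i.1).2 i.2⟩) ⟨?_, ?_⟩)).symm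
  · intro i j hij
    simpa [Subtype.ext_iff] using hij
  · rintro ⟨i | i, hi⟩
    · exact ⟨⟨i, (ha i).1 hi⟩, rfl⟩
    · rw [he, orderOf_xa] at hi
      omega

end QuaternionGroup

theorem stmt_9 (n : ℕ) (hn : 4 ≤ n) :
    ∃ H : Subgroup (QuaternionGroup (2 ^ (n - 2))),
      Nonempty (H ≃* QuaternionGroup 2) ∧ phi H = 6 ∧
        phi (QuaternionGroup (2 ^ (n - 2))) = 2 ^ (n - 2) ∧
        ¬ phi H ∣ phi (QuaternionGroup (2 ^ (n - 2))) := by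
  obtain ⟨k, rfl⟩ := Nat.exists_eq_add_of_le' hn
  have hk : k + 4 - 2 = k + 1 + 1 := by omega
  rw [hk]
  obtain ⟨f, hf⟩ : ∃ f : QuaternionGroup 2 →* QuaternionGroup (2 ^ (k + 1 + 1)),
      Function.Injective f := by
    rw [pow_succ 2 (k + 1)]
    exact QuaternionGroup.exists_injective_monoidHom_mul _ _
  have hH : phi f.range = 6 := by
    rw [← phi_congr (MonoidHom.ofInjective hf), QuaternionGroup.phi_two]
  have hG : phi (QuaternionGroup (2 ^ (k + 1 + 1))) = 2 ^ (k + 1 + 1) := by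
    have h_pos := Nat.one_le_two_pow (n := k)
    rw [QuaternionGroup.phi_eq_totient (by rw [pow_succ, pow_succ]; omega)
      (dvd_pow_self 2 (by omega)), ← pow_succ', Nat.totient_prime_pow_succ Nat.prime_two]
    simp
  refine ⟨f.range, ⟨(MonoidHom.ofInjective hf).symm⟩, hH, hG, fun h => ?_⟩
  rw [hH, hG] at h
  have h3 : 3 ∣ 2 := Nat.prime_three.dvd_of_dvd_pow (dvd_trans (by norm_num) h)
  omega
end

section
/- Let G be a finite non-nilpotent group all of whose proper subgroups are nilpotent (a Schmidt group), and suppose that every Sylow subgroup of G is cyclic. Then φ(G) = 0. -/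
theorem stmt_10 (G : Type*) [Group G] [Finite G]
    (hnn : ¬ Group.IsNilpotent G)
    (hprop : ∀ H : Subgroup G, H ≠ ⊤ → Group.IsNilpotent H)
    (hSyl : ∀ (p : ℕ) (_ : Fact p.Prime) (P : Sylow p G), IsCyclic P) :
    phi G = 0 := by
  have : IsZGroup G := ⟨fun p hp P ↦ hSyl p ⟨hp⟩ P⟩
  have : IsEmpty {a : G // orderOf a = Monoid.exponent G} := by
    refine ⟨fun ⟨a, ha⟩ ↦ hnn ?_⟩
    have : IsCyclic G :=
      isCyclic_of_orderOf_eq_card a (ha.trans (IsZGroup.exponent_eq_card G))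
    let _ : CommGroup G := IsCyclic.commGroup
    exact CommGroup.isNilpotent
  exact Nat.card_of_isEmpty
end

section
/- Let G be a finite non-nilpotent group all of whose proper subgroups are nilpotent (a Schmidt group), with normal Sylow p-subgroup P isomorphic to ℤ_p × ℤ_p for a prime p. Then φ(G) = 0. -/
section

variable {G : Type*} [Group G]

theorem commute_of_commute_commutator_of_coprime {u b : G}
    (hcomm : Commute (u * b * u⁻¹ * b⁻¹) b)
    (hcop : (orderOf (u * b * u⁻¹ * b⁻¹)).Coprime (orderOf b)) : Commute u b := by
  set v := u * b * u⁻¹ * b⁻¹ with hv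
  have h1 : u * b * u⁻¹ = v * b := by simp [hv]
  have h2 : v ^ orderOf b = 1 := by
    have h3 := congrArg (· ^ orderOf b) h1
    simp only [conj_pow, hcomm.mul_pow, pow_orderOf_eq_one] at h3
    simpa using h3.symm
  have h4 : v = 1 := by
    have h5 := Nat.dvd_gcd dvd_rfl (orderOf_dvd_of_pow_eq_one h2)
    rw [hcop.gcd_eq_one] at h5
    simpa using h5
  rw [h4, one_mul] at h1
  exact mul_inv_eq_iff_eq_mul.mp h1

theorem commute_of_mem_normal_of_coprime [Group.IsNilpotent G] (N : Subgroup G)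
    [N.Normal] {u b : G} (hu : u ∈ N) (hcop : (Nat.card N).Coprime (orderOf b)) :
    Commute u b := by
  have key (n : ℕ) : ∀ u ∈ N, u ∈ Subgroup.upperCentralSeries G n → Commute u b := by
    induction n with
    | zero =>
      intro u _ h
      rw [Subgroup.upperCentralSeries_zero, Subgroup.mem_bot] at h
      exact h ▸ Commute.one_left b
    | succ n ih =>
      intro u hu h
      have hN : u * b * u⁻¹ * b⁻¹ ∈ N := by
        have h1 := N.mul_mem hu (Subgroup.Normal.conj_mem ‹_› _ (N.inv_mem hu) b)
        simpa only [mul_assoc] using h1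
      refine commute_of_commute_commutator_of_coprime
        (ih _ hN (Subgroup.mem_upperCentralSeries_succ_iff.mp h b)) ?_
      exact hcop.coprime_dvd_left (N.orderOf_dvd_natCard hN)
  obtain ⟨n, hn⟩ := Group.IsNilpotent.nilpotent (G := G)
  exact key n u hu (hn ▸ Subgroup.mem_top u)

theorem commute_of_mem_nilpotent_subgroup (H P : Subgroup G) [Group.IsNilpotent H]
    [P.Normal] {u b : G} (huH : u ∈ H) (huP : u ∈ P) (hb : b ∈ H)
    (hcop : (Nat.card P).Coprime (orderOf b)) : Commute u b := by
  have h := commute_of_mem_normal_of_coprime (P.subgroupOf H) (u := ⟨u, huH⟩) (b := ⟨b, hb⟩)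
    (Subgroup.mem_subgroupOf.mpr huP) (by
      rw [Subgroup.orderOf_mk]
      refine hcop.coprime_dvd_left ?_
      rw [← Subgroup.inf_subgroupOf_right,
        Nat.card_congr (Subgroup.subgroupOfEquivOfLe (inf_le_right : P ⊓ H ≤ H)).toEquiv]
      exact Subgroup.card_dvd_of_le inf_le_left)
  exact congrArg Subtype.val h

open scoped IsMulCommutative in
/-- The map `u ↦ [u, b]` on an abelian normal subgroup, as a homomorphism. -/
def commutatorHom (P : Subgroup G) [P.Normal] [IsMulCommutative P] (b : G) : P →* P :=
  MonoidHom.mk' (fun u => u * (MulAut.conjNormal b u)⁻¹) fun u w => by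
    rw [map_mul, mul_inv, mul_mul_mul_comm]

theorem commute_of_commute_ne_one_of_coprime [Finite G]
    (hprop : ∀ H : Subgroup G, H ≠ ⊤ → Group.IsNilpotent H)
    (P : Subgroup G) [P.Normal] [IsMulCommutative P] {b x : G}
    (hcop : (Nat.card P).Coprime (orderOf b))
    (hxP : x ∈ P) (hx : x ≠ 1) (hxb : Commute x b) {u : G} (hu : u ∈ P) : Commute u b := by
  set φ := commutatorHom P b
  have hφ (u : P) : (φ u : G) = u * b * (u : G)⁻¹ * b⁻¹ := by
    simp [φ, commutatorHom, mul_assoc]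
  set K := φ.range.map P.subtype
  have hKP : K ≤ P := Subgroup.map_subtype_le _
  have hKmem (w : P) : (φ w : G) ∈ K := ⟨φ w, ⟨w, rfl⟩, rfl⟩
  have hbK : Subgroup.zpowers b ≤ Subgroup.normalizer (K : Set G) := by
    rw [Subgroup.zpowers_le]
    have hle : K.map (MulAut.conj b).toMonoidHom ≤ K := by
      rintro _ ⟨_, ⟨_, ⟨w, rfl⟩, rfl⟩, rfl⟩
      have := hKmem (MulAut.conjNormal b w)
      rw [hφ] at this
      simpa [hφ, mul_assoc] using this
    exact Subgroup.mem_normalizer_fintype fun n hn => hle ⟨n, hn, rfl⟩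
  have hdisj : ∀ g ∈ P, g ∈ Subgroup.zpowers b → g = 1 := by
    intro g hg hgb
    have h1 := Nat.dvd_gcd (P.orderOf_dvd_natCard hg) (orderOf_dvd_of_mem_zpowers hgb)
    rw [hcop.gcd_eq_one] at h1
    simpa using h1
  have hne : K ⊔ Subgroup.zpowers b ≠ ⊤ := by
    intro h
    have hsurj : Function.Surjective φ := by
      intro g
      have hg : (g : G) ∈ (↑(K ⊔ Subgroup.zpowers b) : Set G) := by rw [h]; trivial
      rw [Subgroup.coe_mul_of_right_le_normalizer_left K _ hbK] at hg
      obtain ⟨k, hk, c, hc, hkc⟩ := hg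
      have hcP : c ∈ P := by
        have : c = k⁻¹ * g := by rw [← hkc]; simp
        exact this ▸ P.mul_mem (P.inv_mem (hKP hk)) g.2
      simp only [hdisj c hcP hc, mul_one] at hkc
      obtain ⟨_, ⟨w, rfl⟩, hw⟩ := hk
      exact ⟨w, Subtype.ext (hw.trans hkc)⟩
    have hinj := Finite.injective_iff_surjective.mpr hsurj
    have h1 : φ ⟨x, hxP⟩ = φ 1 := by
      apply Subtype.ext
      rw [hφ, map_one]
      simp [hxb.eq]
    exact hx (congrArg Subtype.val (hinj h1))
  have := hprop _ hne
  have hv := commute_of_mem_nilpotent_subgroup (K ⊔ Subgroup.zpowers b) P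
    ((le_sup_left : K ≤ _) (hKmem ⟨u, hu⟩)) (φ ⟨u, hu⟩).2
    ((le_sup_right : Subgroup.zpowers b ≤ _) (Subgroup.mem_zpowers b)) hcop
  have hord := P.orderOf_dvd_natCard (φ ⟨u, hu⟩).2
  rw [hφ] at hv hord
  exact commute_of_commute_commutator_of_coprime hv (hcop.coprime_dvd_left hord)

theorem isNilpotent_of_isComplement'_of_le_center {P Q : Subgroup G} [P.Normal]
    (hPQ : Subgroup.IsComplement' P Q) (hP : P ≤ Subgroup.center G) [Group.IsNilpotent Q] :
    Group.IsNilpotent G := by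
  have hsurj : Function.Surjective ((QuotientGroup.mk' P).comp Q.subtype) := by
    intro g
    obtain ⟨g, rfl⟩ := QuotientGroup.mk'_surjective P g
    obtain ⟨⟨c, d⟩, hcd⟩ := hPQ.2 g
    refine ⟨d, ?_⟩
    have hc : (QuotientGroup.mk' P) (c : G) = 1 := (QuotientGroup.eq_one_iff _).mpr c.2
    rw [← hcd, map_mul, hc, one_mul]
    rfl
  have : Group.IsNilpotent (G ⧸ P) := Group.nilpotent_of_surjective _ hsurj
  exact Subgroup.isNilpotent_of_ker_le_center (QuotientGroup.mk' P)
    (by rwa [QuotientGroup.ker_mk'])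

/-- If some element has order `exponent G` and `G` is the product of `P` with a cyclic
group of coprime order, then `P` is central. -/
theorem le_center_of_orderOf_eq_exponent [Finite G]
    (hprop : ∀ H : Subgroup G, H ≠ ⊤ → Group.IsNilpotent H)
    (P : Subgroup G) [P.Normal] [IsMulCommutative P] {p : ℕ} (hp : 1 < p)
    (hexp : Monoid.exponent P = p) {a y : G} (ha : orderOf a = Monoid.exponent G)
    (hcop : (Nat.card P).Coprime (orderOf y)) (htop : P ⊔ Subgroup.zpowers y = ⊤) :
    P ≤ Subgroup.center G := by
  set m := orderOf y
  have hm : 0 < m := orderOf_pos y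
  have hindex : P.index ∣ m := by
    have h1 := Subgroup.relIndex_dvd_card P (Subgroup.zpowers y)
    rwa [← Subgroup.relIndex_sup_right, sup_comm, htop, Subgroup.relIndex_top_right,
      Nat.card_zpowers] at h1
  have hamem : a ^ m ∈ P := by
    obtain ⟨k, hk⟩ := hindex
    rw [hk, pow_mul]
    exact P.pow_mem (P.pow_index_mem a) k
  have hmp : m.Coprime p :=
    (hcop.coprime_dvd_left (hexp ▸ Group.exponent_dvd_nat_card)).symm
  have hord : orderOf a = m * p := by
    refine Nat.dvd_antisymm (orderOf_dvd_of_pow_eq_one ?_) ?_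
    · have h1 := Monoid.pow_exponent_eq_one (⟨a ^ m, hamem⟩ : P)
      rw [hexp] at h1
      rw [pow_mul]
      exact congrArg Subtype.val h1
    · rw [ha]
      refine hmp.mul_dvd_of_dvd_of_dvd (Monoid.order_dvd_exponent y) ?_
      rw [← hexp]
      exact Monoid.exponent_dvd_of_monoidHom P.subtype P.subtype_injective
  have hb : orderOf (a ^ p) = m := by
    rw [orderOf_pow_of_dvd (by omega) (hord ▸ dvd_mul_left p m), hord,
      Nat.mul_div_cancel _ (by omega)]
  have hbtop : P ⊔ Subgroup.zpowers (a ^ p) = ⊤ := by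
    apply Subgroup.eq_top_of_le_card
    have h1 : Nat.card P * m ∣ Nat.card ↥(P ⊔ Subgroup.zpowers (a ^ p)) := by
      refine hcop.mul_dvd_of_dvd_of_dvd (Subgroup.card_dvd_of_le le_sup_left) ?_
      rw [← hb, ← Nat.card_zpowers]
      exact Subgroup.card_dvd_of_le le_sup_right
    rw [← P.card_mul_index]
    exact (Nat.mul_le_mul_left _ (Nat.le_of_dvd hm hindex)).trans
      (Nat.le_of_dvd Nat.card_pos h1)
  have hx : a ^ m ≠ 1 := by
    refine pow_ne_one_of_lt_orderOf hm.ne' ?_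
    rw [hord]
    exact lt_mul_right hm hp
  intro u hu
  have hub := commute_of_commute_ne_one_of_coprime hprop P (hb.symm ▸ hcop) hamem hx
    (Commute.pow_pow_self a m p) hu
  have hle : P ⊔ Subgroup.zpowers (a ^ p) ≤ Subgroup.centralizer {u} := by
    refine sup_le (fun w hw => ?_) ?_
    · rw [Subgroup.mem_centralizer_singleton_iff]
      exact setLike_mul_comm hw hu
    · rw [Subgroup.zpowers_le, Subgroup.mem_centralizer_singleton_iff]
      exact hub.symm.eq
  rw [Subgroup.mem_center_iff]
  intro g
  have hg : g ∈ Subgroup.centralizer {u} := hle (hbtop ▸ Subgroup.mem_top g)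
  exact Subgroup.mem_centralizer_singleton_iff.mp hg

end

theorem stmt_11 (G : Type*) [Group G] [Finite G]
    (hnn : ¬ Group.IsNilpotent G)
    (hprop : ∀ H : Subgroup G, H ≠ ⊤ → Group.IsNilpotent H)
    (p : ℕ) [Fact p.Prime] (P : Sylow p G)
    (hnorm : (P : Subgroup G).Normal)
    (hP : Nonempty (P ≃* (Multiplicative (ZMod p) × Multiplicative (ZMod p)))) :
    phi G = 0 := by
  obtain ⟨e⟩ := hP
  have hp : p.Prime := Fact.out
  have hcomm : IsMulCommutative (P : Subgroup G) :=
    ⟨⟨fun u w => e.injective (by rw [map_mul, map_mul, mul_comm])⟩⟩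
  have hexp : Monoid.exponent (P : Subgroup G) = p := by
    rw [Monoid.exponent_eq_of_mulEquiv e, Monoid.exponent_prod, Monoid.exponent_multiplicative,
      ZMod.exponent]
    exact Nat.lcm_self p
  have hnc : ¬ (P : Subgroup G) ≤ Subgroup.center G := by
    intro hcenter
    obtain ⟨Q, hQ⟩ := Subgroup.exists_right_complement'_of_coprime P.card_coprime_index
    have hQtop : Q ≠ ⊤ := by
      rintro rfl
      have h1 : (P : Subgroup G) = ⊥ := Subgroup.isComplement'_top_right.mp hQ
      rw [h1, Monoid.exp_eq_one_iff.mpr inferInstance] at hexp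
      exact hp.one_lt.ne hexp
    have := hprop Q hQtop
    exact hnn (isNilpotent_of_isComplement'_of_le_center hQ hcenter)
  rw [phi, Nat.card_eq_zero]
  refine Or.inl ⟨?_⟩
  rintro ⟨a, ha⟩
  obtain ⟨Q, hQ⟩ := Subgroup.exists_right_complement'_of_coprime P.card_coprime_index
  refine hnc fun u hu => ?_
  have hle : (P : Subgroup G) ⊔ Q ≤ Subgroup.centralizer {u} := by
    refine sup_le (fun w hw => ?_) fun y hy => ?_
    · rw [Subgroup.mem_centralizer_singleton_iff]
      exact setLike_mul_comm hw hu
    · rw [Subgroup.mem_centralizer_singleton_iff]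
      have hcop : (Nat.card (P : Subgroup G)).Coprime (orderOf y) := by
        refine P.card_coprime_index.coprime_dvd_right ?_
        rw [hQ.symm.index_eq_card]
        exact Q.orderOf_dvd_natCard hy
      have := hprop ((P : Subgroup G) ⊔ Subgroup.zpowers y) fun h =>
        hnc (le_center_of_orderOf_eq_exponent hprop P hp.one_lt hexp ha hcop h)
      exact (commute_of_mem_nilpotent_subgroup ((P : Subgroup G) ⊔ Subgroup.zpowers y) P
        ((le_sup_left : (P : Subgroup G) ≤ _) hu) hu
        ((le_sup_right : Subgroup.zpowers y ≤ _) (Subgroup.mem_zpowers y)) hcop).symm.eq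
  rw [Subgroup.mem_center_iff]
  intro g
  have hg : g ∈ Subgroup.centralizer {u} := hle (hQ.sup_eq_top ▸ Subgroup.mem_top g)
  exact Subgroup.mem_centralizer_singleton_iff.mp hg
end
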